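/- Let G be a graph and c a map assigning to each vertex v a pair (c1(v), c2(v)) of integers with -1 <= c1(v) <= 1 and -1 <= c2(v) <= 3. If G is c-critical (not c-colorable but every proper subgraph is c-colorable), then the minimum over subsets A of V(G) of (sum over v in A of (1 + 4 c1(v) + 3 c2(v)) minus 9 |E(G[A])|) is at most -6. -/

import Mathlib

/-- A c-coloring of G: each vertex v gets a color in {1,2} (here 0 or 1 in `Fin 2`),
and has at most c_i(v) like-colored neighbors where i is its color. -/
def CColorable {V : Type*} (G : SimpleGraph V) (c1 c2 : V → ℤ) : Prop :=
  ∃ f : V → Fin 2, ∀ v,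
    ((G.neighborSet v ∩ {u | f u = f v}).ncard : ℤ) ≤ if f v = 0 then c1 v else c2 v

/-- The number of edges of G with both endpoints in A. -/
noncomputable def edgesIn {V : Type*} (G : SimpleGraph V) (A : Set V) : ℕ :=
  {e ∈ G.edgeSet | ∀ v ∈ e, v ∈ A}.ncard

namespace DefectiveColoring

/-- A symmetric nonnegative integer multiplicity function without loops. -/
structure IsMult {V : Type*} (g : V → V → ℤ) : Prop where
  symm : ∀ x y, g x y = g y x
  nonneg : ∀ x y, 0 ≤ g x y
  irrefl : ∀ x, g x x = 0

/-- Vertex weights minus edge weights inside `A`. -/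
def excess {V : Type*} (w : V → ℤ) (h : V → V → ℤ) (A : Finset V) : ℤ :=
  ∑ x ∈ A, w x - (∑ x ∈ A, ∑ y ∈ A, h x y) / 2

section Excess

variable {V : Type*} {w : V → ℤ} {h : V → V → ℤ}

@[simp]
lemma excess_empty : excess w h ∅ = 0 := by simp [excess]

lemma excess_weight_sub (w' : V → ℤ) (A : Finset V) :
    excess w' h A = excess w h A - ∑ x ∈ A, (w x - w' x) := by
  unfold excess
  rw [Finset.sum_sub_distrib]
  ring

variable [DecidableEq V]

lemma excess_insert (hh : IsMult h) {x : V} {A : Finset V} (hx : x ∉ A) :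
    excess w h (insert x A) = excess w h A + w x - ∑ y ∈ A, h x y := by
  have e1 : ∑ a ∈ insert x A, ∑ y ∈ insert x A, h a y
      = ∑ a ∈ A, ∑ y ∈ A, h a y + 2 * ∑ y ∈ A, h x y := by
    rw [Finset.sum_insert hx, Finset.sum_insert hx, hh.irrefl]
    have : ∀ a ∈ A, ∑ y ∈ insert x A, h a y = h x a + ∑ y ∈ A, h a y := by
      intro a _
      rw [Finset.sum_insert hx, hh.symm]
    rw [Finset.sum_congr rfl this, Finset.sum_add_distrib]
    ring
  unfold excess
  rw [e1, Finset.sum_insert hx]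
  omega

lemma excess_singleton (hh : IsMult h) (x : V) : excess w h {x} = w x := by
  have := excess_insert (w := w) hh (Finset.notMem_empty x)
  simpa using this

lemma two_mul_excess (hh : IsMult h) (A : Finset V) :
    2 * excess w h A = ∑ x ∈ A, (2 * w x - ∑ y ∈ A, h x y) := by
  induction A using Finset.induction_on with
  | empty => simp
  | insert x A hx ih =>
    rw [excess_insert hh hx, Finset.sum_insert hx, Finset.sum_insert hx, hh.irrefl]
    have : ∀ a ∈ A, 2 * w a - ∑ y ∈ insert x A, h a y
        = (2 * w a - ∑ y ∈ A, h a y) - h x a := by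
      intro a _
      rw [Finset.sum_insert hx, hh.symm]
      ring
    rw [Finset.sum_congr rfl this, Finset.sum_sub_distrib, ← ih]
    ring

lemma excess_union (hh : IsMult h) {A B : Finset V} (hd : Disjoint A B) :
    excess w h (A ∪ B) = excess w h A + excess w h B - ∑ y ∈ B, ∑ x ∈ A, h x y := by
  induction B using Finset.induction_on with
  | empty => simp
  | insert x B hx ih =>
    rw [Finset.disjoint_insert_right] at hd
    have hx' : x ∉ A ∪ B := by simp [hx, hd.1]
    rw [Finset.union_insert, excess_insert hh hx', ih hd.2, excess_insert hh hx,
      Finset.sum_insert hx, Finset.sum_union hd.2]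
    have : ∑ y ∈ A, h x y = ∑ y ∈ A, h y x := Finset.sum_congr rfl fun y _ => hh.symm x y
    rw [this]
    ring

lemma excess_submod (hh : IsMult h) (A B : Finset V) :
    excess w h (A ∪ B) + excess w h (A ∩ B) ≤ excess w h A + excess w h B := by
  have h1 := excess_union (w := w) hh (A := A) (B := B \ A) Finset.disjoint_sdiff
  have h2 := excess_union (w := w) hh (A := A ∩ B) (B := B \ A)
    (Finset.disjoint_of_subset_left Finset.inter_subset_left Finset.disjoint_sdiff)
  have e1 : A ∪ B \ A = A ∪ B := Finset.union_sdiff_self_eq_union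
  have e2 : A ∩ B ∪ B \ A = B := by
    ext z; simp only [Finset.mem_union, Finset.mem_inter, Finset.mem_sdiff]; tauto
  rw [e1] at h1
  rw [e2] at h2
  have h3 : ∑ y ∈ B \ A, ∑ x ∈ A ∩ B, h x y ≤ ∑ y ∈ B \ A, ∑ x ∈ A, h x y :=
    Finset.sum_le_sum fun y _ => Finset.sum_le_sum_of_subset_of_nonneg
      Finset.inter_subset_left fun x _ _ => hh.nonneg x y
  linarith

end Excess

/-- The weight of a vertex with capacities `a` (first color) and `b` (second color). -/
def weight (a b : ℤ) : ℤ := 1 + 4 * max a (-1) + 3 * max b 0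

section Potential

variable {V : Type*}

/-- The potential without the penalty for vertices that cannot use the second color. -/
def rho (e f : V → V → ℤ) (c1 c2 : V → ℤ) (A : Finset V) : ℤ :=
  excess (fun x => weight (c1 x) (c2 x)) (fun x y => 9 * e x y + 4 * f x y) A

/-- The penalty: `3` if some vertex of `A` cannot use the second color. -/
def penalty (c2 : V → ℤ) (A : Finset V) : ℤ := if ∃ x ∈ A, c2 x < 0 then 3 else 0

/-- The potential of a vertex set. -/
def pot (e f : V → V → ℤ) (c1 c2 : V → ℤ) (A : Finset V) : ℤ :=
  rho e f c1 c2 A - penalty c2 A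

/-- A coloring of `X` (`true` is the second color) in which every pair `x`, `y` of distinct colors
distributes its `f x y` weak edges as loads `o x y` on `x` and `o y x` on `y`. -/
structure IsCol (e f : V → V → ℤ) (c1 c2 : V → ℤ) (X : Finset V)
    (φ : V → Bool) (o : V → V → ℤ) : Prop where
  nonneg : ∀ x y, 0 ≤ o x y
  cover : ∀ x ∈ X, ∀ y ∈ X, φ x ≠ φ y → f x y ≤ o x y + o y x
  load : ∀ x ∈ X, ∑ y ∈ X, (if φ x = φ y then e x y else o x y)
    ≤ if φ x then c2 x else c1 x

/-- Admissible data: strong edges `e` are simple, weak edges `f` form a multigraph. -/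
structure Valid (e f : V → V → ℤ) (c1 c2 : V → ℤ) : Prop where
  mult_e : IsMult e
  e_le : ∀ x y, e x y ≤ 1
  mult_f : IsMult f
  c1_le : ∀ x, c1 x ≤ 1
  c2_le : ∀ x, c2 x ≤ 3

variable {e f : V → V → ℤ} {c1 c2 : V → ℤ} {X : Finset V}

lemma Valid.mult (H : Valid e f c1 c2) : IsMult (fun x y => 9 * e x y + 4 * f x y) where
  symm x y := by rw [H.mult_e.symm, H.mult_f.symm]
  nonneg x y := by
    have := H.mult_e.nonneg x y
    have := H.mult_f.nonneg x y
    positivity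
  irrefl x := by rw [H.mult_e.irrefl, H.mult_f.irrefl]; rfl

lemma Valid.mono (H : Valid e f c1 c2) {c1' c2' : V → ℤ} (h1 : ∀ x, c1' x ≤ c1 x)
    (h2 : ∀ x, c2' x ≤ c2 x) : Valid e f c1' c2' :=
  ⟨H.mult_e, H.e_le, H.mult_f, fun x => (h1 x).trans (H.c1_le x),
    fun x => (h2 x).trans (H.c2_le x)⟩

lemma penalty_nonneg (A : Finset V) : 0 ≤ penalty c2 A := by
  unfold penalty; split_ifs <;> norm_num

lemma penalty_le (A : Finset V) : penalty c2 A ≤ 3 := by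
  unfold penalty; split_ifs <;> norm_num

lemma penalty_eq_zero {A : Finset V} (h : ∀ x ∈ A, 0 ≤ c2 x) : penalty c2 A = 0 := by
  unfold penalty
  rw [if_neg]
  rintro ⟨x, hx, h'⟩
  exact absurd (h x hx) (by omega)

lemma penalty_eq_three {A : Finset V} {x : V} (hx : x ∈ A) (h : c2 x < 0) :
    penalty c2 A = 3 := if_pos ⟨x, hx, h⟩

lemma pot_eq_rho {A : Finset V} (h : ∀ x ∈ A, 0 ≤ c2 x) :
    pot e f c1 c2 A = rho e f c1 c2 A := by
  rw [pot, penalty_eq_zero h, sub_zero]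

lemma penalty_mono {A B : Finset V} (h : A ⊆ B) : penalty c2 A ≤ penalty c2 B := by
  by_cases hA : ∃ x ∈ A, c2 x < 0
  · obtain ⟨x, hx, hx'⟩ := hA
    rw [penalty_eq_three hx hx', penalty_eq_three (h hx) hx']
  · push Not at hA
    rw [penalty_eq_zero hA]
    exact penalty_nonneg B

/-- Lowering the capacities by `δ1`, `δ2` lowers the potential by at most `4 δ1 + 3 δ2`. -/
lemma pot_sub_cost_le {c1' c2' δ1 δ2 : V → ℤ} {A : Finset V}
    (hδ1 : ∀ x ∈ A, 0 ≤ δ1 x) (hδ2 : ∀ x ∈ A, 0 ≤ δ2 x)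
    (h1 : ∀ x ∈ A, c1 x - δ1 x ≤ c1' x) (h2 : ∀ x ∈ A, c2 x - δ2 x ≤ c2' x) :
    pot e f c1 c2 A - ∑ x ∈ A, (4 * δ1 x + 3 * δ2 x) ≤ pot e f c1' c2' A := by
  classical
  have key : ∀ x ∈ A, weight (c1 x) (c2 x) - weight (c1' x) (c2' x) ≤ 4 * δ1 x + 3 * δ2 x := by
    intro x hx
    have := hδ1 x hx; have := hδ2 x hx; have := h1 x hx; have := h2 x hx
    unfold weight
    omega
  unfold pot rho
  rw [excess_weight_sub (w := fun x => weight (c1 x) (c2 x))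
    (fun x => weight (c1' x) (c2' x)) A]
  by_cases hp : penalty c2' A ≤ penalty c2 A
  · have := Finset.sum_le_sum key
    linarith
  · have hA : ∀ x ∈ A, 0 ≤ c2 x := by
      intro x hx
      by_contra hlt
      rw [penalty_eq_three hx (not_le.mp hlt)] at hp
      exact hp (penalty_le A)
    obtain ⟨z, hz, hz'⟩ : ∃ z ∈ A, c2' z < 0 := by
      by_contra! hn
      rw [penalty_eq_zero hn, penalty_eq_zero hA] at hp
      exact hp le_rfl
    rw [penalty_eq_zero hA, penalty_eq_three hz hz']
    have hz3 : weight (c1 z) (c2 z) - weight (c1' z) (c2' z) + 3 ≤ 4 * δ1 z + 3 * δ2 z := by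
      have := hδ1 z hz; have := hδ2 z hz; have := h1 z hz; have := h2 z hz; have := hA z hz
      unfold weight
      omega
    have hr := Finset.sum_le_sum (s := A.erase z) fun x hx => key x (Finset.mem_of_mem_erase hx)
    have s1 := Finset.add_sum_erase A
      (fun x => weight (c1 x) (c2 x) - weight (c1' x) (c2' x)) hz
    have s2 := Finset.add_sum_erase A (fun x => 4 * δ1 x + 3 * δ2 x) hz
    linarith

lemma IsCol.load_nonneg (H : Valid e f c1 c2) {φ : V → Bool} {o : V → V → ℤ} {Y : Finset V}
    {d1 d2 : V → ℤ} (hc : IsCol e f d1 d2 Y φ o) {x : V} (hx : x ∈ Y) :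
    0 ≤ if φ x then d2 x else d1 x := by
  refine le_trans (Finset.sum_nonneg fun y _ => ?_) (hc.load x hx)
  split_ifs
  · exact H.mult_e.nonneg x y
  · exact hc.nonneg x y

@[simp]
lemma rho_empty : rho e f c1 c2 ∅ = 0 := excess_empty

variable [DecidableEq V]

lemma rho_insert (H : Valid e f c1 c2) {x : V} {A : Finset V} (hx : x ∉ A) :
    rho e f c1 c2 (insert x A) = rho e f c1 c2 A + weight (c1 x) (c2 x)
      - 9 * ∑ y ∈ A, e x y - 4 * ∑ y ∈ A, f x y := by
  unfold rho
  rw [excess_insert H.mult hx, Finset.sum_add_distrib, Finset.mul_sum, Finset.mul_sum]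
  ring

lemma rho_singleton (H : Valid e f c1 c2) (x : V) :
    rho e f c1 c2 {x} = weight (c1 x) (c2 x) := excess_singleton H.mult x

lemma rho_union (H : Valid e f c1 c2) {A B : Finset V} (hd : Disjoint A B) :
    rho e f c1 c2 (A ∪ B) = rho e f c1 c2 A + rho e f c1 c2 B
      - ∑ y ∈ B, ∑ x ∈ A, (9 * e x y + 4 * f x y) := excess_union H.mult hd

lemma rho_submod (H : Valid e f c1 c2) (A B : Finset V) :
    rho e f c1 c2 (A ∪ B) + rho e f c1 c2 (A ∩ B) ≤ rho e f c1 c2 A + rho e f c1 c2 B :=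
  excess_submod H.mult A B

/-- Data of a smallest uncolorable set whose nonempty subsets have potential at least `-5`. -/
structure MinCE (e f : V → V → ℤ) (c1 c2 : V → ℤ) (X : Finset V) : Prop where
  valid : Valid e f c1 c2
  pot_ge : ∀ A ⊆ X, A.Nonempty → -5 ≤ pot e f c1 c2 A
  not_col : ¬ ∃ φ o, IsCol e f c1 c2 X φ o
  minimal : ∀ (Y : Finset V) (f' : V → V → ℤ) (c1' c2' : V → ℤ), Y.card < X.card →
    Valid e f' c1' c2' → (∀ A ⊆ Y, A.Nonempty → -5 ≤ pot e f' c1' c2' A) →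
    ∃ φ o, IsCol e f' c1' c2' Y φ o

/-- Putting a vertex `x` of color `i` back, with loads `p` on the remaining vertices. -/
lemma Valid.exists_isCol_insert (H : Valid e f c1 c2) {x : V} (hx : x ∈ X) {φ : V → Bool}
    {o : V → V → ℤ} {i : Bool} {p : V → ℤ} (ho : ∀ a b, 0 ≤ o a b)
    (hcov : ∀ a ∈ X.erase x, ∀ b ∈ X.erase x, φ a ≠ φ b → f a b ≤ o a b + o b a)
    (hload : ∀ a ∈ X.erase x, ∑ y ∈ X.erase x, (if φ a = φ y then e a y else o a y)
      + (if i = φ a then e x a else p a) ≤ if φ a then c2 a else c1 a)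
    (hp : ∀ y, 0 ≤ p y ∧ p y ≤ f x y)
    (hl : ∑ y ∈ X.erase x, (if i = φ y then e x y else f x y - p y)
      ≤ if i then c2 x else c1 x) :
    ∃ φ' o', IsCol e f c1 c2 X φ' o' := by
  refine ⟨Function.update φ x i, fun a b => if a = x then f x b - p b else if b = x then p a
    else o a b, ⟨?_, ?_, ?_⟩⟩
  · intro a b
    split_ifs
    · have := (hp b).2; omega
    · exact (hp a).1
    · exact ho a b
  · intro a ha b hb hab
    by_cases hax : a = x
    · by_cases hbx : b = x
      · subst hax hbx
        exact absurd rfl hab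
      · simp [hax, hbx]
    · by_cases hbx : b = x
      · simp only [hax, hbx, if_true, if_false]
        rw [H.mult_f.symm a x]; omega
      · simp only [hax, hbx, if_false]
        apply hcov a (by simp [hax, ha]) b (by simp [hbx, hb])
        simpa [Function.update_of_ne hax, Function.update_of_ne hbx] using hab
  · intro a ha
    rw [← Finset.add_sum_erase X _ hx]
    by_cases hax : a = x
    · subst hax
      simp only [Function.update_self, if_true, H.mult_e.irrefl, zero_add]
      refine le_trans (le_of_eq (Finset.sum_congr rfl fun y hy => ?_)) hl
      rw [Function.update_of_ne (Finset.ne_of_mem_erase hy)]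
    · have h1 := hload a (by simp [hax, ha])
      simp only [hax, if_true, if_false, Function.update_self, Function.update_of_ne hax]
      have e1 : ∑ y ∈ X.erase x, (if φ a = Function.update φ x i y then e a y
          else if y = x then p a else o a y)
          = ∑ y ∈ X.erase x, (if φ a = φ y then e a y else o a y) := by
        refine Finset.sum_congr rfl fun y hy => ?_
        have hyx := Finset.ne_of_mem_erase hy
        rw [Function.update_of_ne hyx, if_neg hyx]
      rw [e1]
      have e2 : (if φ a = i then e a x else p a) = if i = φ a then e x a else p a := by
        rw [H.mult_e.symm a x]
        simp only [eq_comm]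
      rw [e2]
      linarith

/-- Deleting `x`, coloring the rest with lowered capacities, and putting `x` back. -/
lemma MinCE.extend (H : MinCE e f c1 c2 X) {x : V} (hx : x ∈ X) (δ1 δ2 : V → ℤ)
    (hδ1 : ∀ y, 0 ≤ δ1 y) (hδ2 : ∀ y, 0 ≤ δ2 y)
    (budget : ∀ A ⊆ X.erase x, A.Nonempty →
      ∑ y ∈ A, (4 * δ1 y + 3 * δ2 y) ≤ pot e f c1 c2 A + 5)
    (ext : ∀ φ : V → Bool,
      (∀ y ∈ X.erase x, 0 ≤ if φ y then c2 y - δ2 y else c1 y - δ1 y) →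
      ∃ (i : Bool) (p : V → ℤ), (∀ y, 0 ≤ p y ∧ p y ≤ f x y) ∧
        ∑ y ∈ X.erase x, (if i = φ y then e x y else f x y - p y) ≤ (if i then c2 x else c1 x) ∧
        ∀ y ∈ X.erase x, (if i = φ y then e x y else p y) ≤ if φ y then δ2 y else δ1 y) :
    False := by
  have V' := H.valid.mono (c1' := fun y => c1 y - δ1 y) (c2' := fun y => c2 y - δ2 y)
    (fun y => by have := hδ1 y; omega) (fun y => by have := hδ2 y; omega)
  obtain ⟨φ, o, hc⟩ := H.minimal (X.erase x) f (fun y => c1 y - δ1 y) (fun y => c2 y - δ2 y)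
    (Finset.card_erase_lt_of_mem hx) V' (by
      intro A hA hne
      have := pot_sub_cost_le (e := e) (f := f) (c1 := c1) (c2 := c2)
        (c1' := fun y => c1 y - δ1 y) (c2' := fun y => c2 y - δ2 y) (δ1 := δ1) (δ2 := δ2) (A := A)
        (fun y _ => hδ1 y) (fun y _ => hδ2 y) (fun y _ => le_rfl) (fun y _ => le_rfl)
      have := budget A hA hne
      linarith)
  obtain ⟨i, p, hp, hl, hr⟩ := ext φ fun y hy => hc.load_nonneg H.valid hy
  refine H.not_col (H.valid.exists_isCol_insert hx hc.nonneg hc.cover (fun a ha => ?_) hp hl)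
  have h1 := hc.load a ha
  have h2 := hr a ha
  split_ifs at h1 h2 ⊢ <;> linarith

end Potential

section Union

variable {V : Type*} {e f p q : V → V → ℤ} {c1 c2 : V → ℤ} {X S R : Finset V}

/-- Parts `p` of the weak edges and `q` of the strong edges whose load is reserved in advance. -/
structure IsReserve (e f p q : V → V → ℤ) : Prop where
  p_nonneg : ∀ x y, 0 ≤ p x y
  p_le : ∀ x y, p x y ≤ f x y
  q_nonneg : ∀ x y, 0 ≤ q x y
  q_le : ∀ x y, q x y ≤ e x y

lemma Valid.isReserve_zero (H : Valid e f c1 c2) : IsReserve e f 0 0 :=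
  ⟨fun _ _ => le_rfl, H.mult_f.nonneg, fun _ _ => le_rfl, H.mult_e.nonneg⟩

/-- The first capacities left by a colored set `S`. -/
def left1 (e f p q : V → V → ℤ) (φ : V → Bool) (S : Finset V) (c1 : V → ℤ) (y : V) : ℤ :=
  c1 y - ∑ s ∈ S, if φ s then f s y - p s y else q s y + 9 * (e s y - q s y)

/-- The second capacities left by a colored set `S`. -/
def left2 (e f p q : V → V → ℤ) (φ : V → Bool) (S : Finset V) (c2 : V → ℤ) (y : V) : ℤ :=
  c2 y - ∑ s ∈ S, if φ s then q s y + 9 * (e s y - q s y) else f s y - p s y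

/-- The gain at `y` of an edge to `s` in the gap inequality. -/
def gain (e f p q : V → V → ℤ) (φ : V → Bool) (s y : V) : ℤ :=
  if φ s then 6 * q s y + 4 * p s y else e s y + f s y + 4 * q s y + 3 * p s y

lemma IsReserve.left1_term_nonneg (hr : IsReserve e f p q) (φ : V → Bool) (s y : V) :
    0 ≤ if φ s then f s y - p s y else q s y + 9 * (e s y - q s y) := by
  have := hr.p_le s y; have := hr.q_le s y; have := hr.q_nonneg s y
  split_ifs <;> omega

lemma IsReserve.left2_term_nonneg (hr : IsReserve e f p q) (φ : V → Bool) (s y : V) :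
    0 ≤ if φ s then q s y + 9 * (e s y - q s y) else f s y - p s y := by
  have := hr.p_le s y; have := hr.q_le s y; have := hr.q_nonneg s y
  split_ifs <;> omega

lemma IsReserve.left1_le (hr : IsReserve e f p q) (φ : V → Bool) (S : Finset V) (y : V) :
    left1 e f p q φ S c1 y ≤ c1 y :=
  sub_le_self _ (Finset.sum_nonneg fun s _ => hr.left1_term_nonneg φ s y)

lemma IsReserve.left2_le (hr : IsReserve e f p q) (φ : V → Bool) (S : Finset V) (y : V) :
    left2 e f p q φ S c2 y ≤ c2 y :=
  sub_le_self _ (Finset.sum_nonneg fun s _ => hr.left2_term_nonneg φ s y)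

lemma IsReserve.gain_nonneg (hr : IsReserve e f p q) (φ : V → Bool) (s y : V) :
    0 ≤ gain e f p q φ s y := by
  have := hr.p_le s y; have := hr.q_le s y; have := hr.q_nonneg s y; have := hr.p_nonneg s y
  unfold gain
  split_ifs <;> omega

lemma Valid.left (H : Valid e f c1 c2) (hr : IsReserve e f p q) (φ : V → Bool) (S : Finset V) :
    Valid e f (left1 e f p q φ S c1) (left2 e f p q φ S c2) :=
  H.mono (fun y => hr.left1_le φ S y) (fun y => hr.left2_le φ S y)

/-- The weight drop at a vertex outside of the colored set. -/
lemma Valid.weight_drop (H : Valid e f c1 c2) (hr : IsReserve e f p q) (φ : V → Bool)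
    (S : Finset V) (y : V) :
    weight (c1 y) (c2 y) - weight (left1 e f p q φ S c1 y) (left2 e f p q φ S c2 y)
      ≤ ∑ s ∈ S, (9 * e s y + 4 * f s y - gain e f p q φ s y) := by
  have hb : ∀ s, 0 ≤ p s y ∧ p s y ≤ f s y ∧ 0 ≤ q s y ∧ q s y ≤ e s y := fun s =>
    ⟨hr.p_nonneg s y, hr.p_le s y, hr.q_nonneg s y, hr.q_le s y⟩
  have h1 : 4 * (max (c1 y) (-1) - max (left1 e f p q φ S c1 y) (-1))
      ≤ ∑ s ∈ S, if φ s then 4 * (f s y - p s y) else 4 * q s y + 8 * (e s y - q s y) := by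
    by_cases hs : ∃ s ∈ S, φ s = false ∧ q s y < e s y
    · obtain ⟨s, hs, hφ, hq⟩ := hs
      have := Finset.single_le_sum (f := fun s => if φ s then 4 * (f s y - p s y)
        else 4 * q s y + 8 * (e s y - q s y)) (fun s _ => by
          have := hb s
          split_ifs <;> omega) hs
      simp only [hφ] at this
      have := hb s
      have := H.c1_le y
      simp only [Bool.false_eq_true, if_false] at *
      omega
    · push Not at hs
      have : ∑ s ∈ S, (if φ s then 4 * (f s y - p s y) else 4 * q s y + 8 * (e s y - q s y))
          = 4 * ∑ s ∈ S, if φ s then f s y - p s y else q s y + 9 * (e s y - q s y) := by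
        rw [Finset.mul_sum]
        refine Finset.sum_congr rfl fun s h => ?_
        have h1 := hs s h
        have h2 := hb s
        cases hφ : φ s
        · have := h1 hφ
          simp only [Bool.false_eq_true, if_false]
          omega
        · simp
      rw [this]
      have h0 : 0 ≤ ∑ s ∈ S, if φ s then f s y - p s y else q s y + 9 * (e s y - q s y) :=
        Finset.sum_nonneg fun s _ => hr.left1_term_nonneg φ s y
      unfold left1
      omega
  have h2 : 3 * (max (c2 y) 0 - max (left2 e f p q φ S c2 y) 0)
      ≤ ∑ s ∈ S, if φ s then 3 * q s y + 9 * (e s y - q s y) else 3 * (f s y - p s y) := by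
    by_cases hs : ∃ s ∈ S, φ s = true ∧ q s y < e s y
    · obtain ⟨s, hs, hφ, hq⟩ := hs
      have := Finset.single_le_sum (f := fun s => if φ s then 3 * q s y + 9 * (e s y - q s y)
        else 3 * (f s y - p s y)) (fun s _ => by
          have := hb s
          split_ifs <;> omega) hs
      simp only [hφ, if_true] at this
      have := hb s
      have := H.c2_le y
      omega
    · push Not at hs
      have : ∑ s ∈ S, (if φ s then 3 * q s y + 9 * (e s y - q s y) else 3 * (f s y - p s y))
          = 3 * ∑ s ∈ S, if φ s then q s y + 9 * (e s y - q s y) else f s y - p s y := by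
        rw [Finset.mul_sum]
        refine Finset.sum_congr rfl fun s h => ?_
        have h1 := hs s h
        have h2 := hb s
        cases hφ : φ s
        · simp
        · have := h1 hφ
          simp only [if_true]
          omega
      rw [this]
      have h0 : 0 ≤ ∑ s ∈ S, if φ s then q s y + 9 * (e s y - q s y) else f s y - p s y :=
        Finset.sum_nonneg fun s _ => hr.left2_term_nonneg φ s y
      unfold left2
      omega
  have h3 : ∑ s ∈ S, (9 * e s y + 4 * f s y - gain e f p q φ s y)
      = ∑ s ∈ S, (if φ s then 4 * (f s y - p s y) else 4 * q s y + 8 * (e s y - q s y))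
      + ∑ s ∈ S, if φ s then 3 * q s y + 9 * (e s y - q s y) else 3 * (f s y - p s y) := by
    rw [← Finset.sum_add_distrib]
    refine Finset.sum_congr rfl fun s _ => ?_
    unfold gain
    split_ifs <;> ring
  rw [h3]
  unfold weight
  linarith

/-- A coloring stays valid when the capacities on the colored set grow. -/
lemma IsCol.congr_caps {φ : V → Bool} {o : V → V → ℤ} (hS : IsCol e f c1 c2 S φ o)
    {d1 d2 : V → ℤ} (h1 : ∀ x ∈ S, c1 x ≤ d1 x) (h2 : ∀ x ∈ S, c2 x ≤ d2 x) :
    IsCol e f d1 d2 S φ o :=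
  ⟨hS.nonneg, hS.cover, fun x hx => (hS.load x hx).trans (by
    have := h1 x hx; have := h2 x hx
    split_ifs <;> assumption)⟩

/-- The slack condition without reserves. -/
lemma IsCol.slack_zero {φ : V → Bool} {o : V → V → ℤ} (hS : IsCol e f c1 c2 S φ o) :
    ∀ s ∈ S, ∑ y ∈ S, (if φ s = φ y then e s y else o s y)
      + ∑ y ∈ R, ((0 : V → V → ℤ) s y + (0 : V → V → ℤ) s y) ≤ if φ s then c2 s else c1 s := by
  intro s hs
  simpa using hS.load s hs

variable [DecidableEq V]

/-- The excess after coloring `S`, compared with the excess of the union. -/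
lemma Valid.rho_union_le (H : Valid e f c1 c2) (hr : IsReserve e f p q) (φ : V → Bool)
    {A : Finset V} (hd : Disjoint S A) :
    rho e f c1 c2 (S ∪ A) + ∑ y ∈ A, ∑ s ∈ S, gain e f p q φ s y ≤ rho e f c1 c2 S
      + rho e f (left1 e f p q φ S c1) (left2 e f p q φ S c2) A := by
  rw [rho_union H hd]
  have h1 : rho e f (left1 e f p q φ S c1) (left2 e f p q φ S c2) A
      = rho e f c1 c2 A - ∑ y ∈ A, (weight (c1 y) (c2 y)
        - weight (left1 e f p q φ S c1 y) (left2 e f p q φ S c2 y)) :=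
    excess_weight_sub _ A
  have h2 := Finset.sum_le_sum (s := A) fun y _ => H.weight_drop hr φ S y
  simp only [Finset.sum_sub_distrib] at h1 h2 ⊢
  linarith

/-- Gluing a coloring of `S` with reserved loads and a coloring of `R` in the left capacities. -/
lemma IsCol.union (H : Valid e f c1 c2) (hr : IsReserve e f p q) {φ ψ : V → Bool}
    {o o' : V → V → ℤ} (hS : IsCol e f c1 c2 S φ o) (hd : Disjoint S R)
    (slack : ∀ s ∈ S, ∑ y ∈ S, (if φ s = φ y then e s y else o s y)
      + ∑ y ∈ R, (p s y + q s y) ≤ if φ s then c2 s else c1 s)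
    (hR : IsCol e f (left1 e f p q φ S c1) (left2 e f p q φ S c2) R ψ o') :
    ∃ o'', IsCol e f c1 c2 (S ∪ R) (fun x => if x ∈ S then φ x else ψ x) o'' := by
  have hRS : ∀ y ∈ R, y ∉ S := fun y hy hy' => Finset.disjoint_left.mp hd hy' hy
  refine ⟨fun a b => if a ∈ S then (if b ∈ S then o a b else p a b)
    else if b ∈ S then f b a - p b a else o' a b, ⟨?_, ?_, ?_⟩⟩
  · intro a b
    split_ifs
    · exact hS.nonneg a b
    · exact hr.p_nonneg a b
    · have := hr.p_le b a; omega
    · exact hR.nonneg a b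
  · intro a ha b hb hab
    by_cases h1 : a ∈ S <;> by_cases h2 : b ∈ S <;> simp only [h1, h2, if_true, if_false] at hab ⊢
    · exact hS.cover a h1 b h2 hab
    · omega
    · rw [H.mult_f.symm a b]; omega
    · exact hR.cover a ((Finset.mem_union.mp ha).resolve_left h1) b
        ((Finset.mem_union.mp hb).resolve_left h2) hab
  · intro a ha
    rw [Finset.sum_union hd]
    by_cases h1 : a ∈ S
    · simp only [h1, if_true]
      have e1 : ∑ y ∈ S, (if φ a = (if y ∈ S then φ y else ψ y) then e a y
          else if y ∈ S then o a y else p a y)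
          = ∑ y ∈ S, (if φ a = φ y then e a y else o a y) :=
        Finset.sum_congr rfl fun y hy => by simp only [hy, if_true]
      rw [e1]
      have hle : ∑ y ∈ R, (if φ a = (if y ∈ S then φ y else ψ y) then e a y
          else if y ∈ S then o a y else p a y) ≤ ∑ y ∈ R, (p a y + q a y) := by
        refine Finset.sum_le_sum fun y hy => ?_
        have hyS := hRS y hy
        simp only [hyS, if_false]
        have hp := hr.p_nonneg a y
        have hq := hr.q_nonneg a y
        have hqe := hr.q_le a y
        have hpf := hr.p_le a y
        have hload := hR.load_nonneg H hy
        split_ifs with hay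
        · by_contra hlt
          rw [← hay] at hload
          cases hφ : φ a
          · simp only [hφ, Bool.false_eq_true, if_false] at hload
            unfold left1 at hload
            have hs := Finset.single_le_sum (f := fun s => if φ s then f s y - p s y
              else q s y + 9 * (e s y - q s y)) (fun s _ => hr.left1_term_nonneg φ s y) h1
            simp only [hφ, Bool.false_eq_true, if_false] at hs
            have := H.c1_le y
            omega
          · simp only [hφ, if_true] at hload
            unfold left2 at hload
            have hs := Finset.single_le_sum (f := fun s => if φ s then
              q s y + 9 * (e s y - q s y) else f s y - p s y)
              (fun s _ => hr.left2_term_nonneg φ s y) h1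
            simp only [hφ, if_true] at hs
            have := H.c2_le y
            omega
        · omega
      have := slack a h1
      linarith
    · have haR := (Finset.mem_union.mp ha).resolve_left h1
      simp only [h1, if_false]
      have e1 : ∑ y ∈ R, (if ψ a = (if y ∈ S then φ y else ψ y) then e a y
          else if y ∈ S then f y a - p y a else o' a y)
          = ∑ y ∈ R, (if ψ a = ψ y then e a y else o' a y) :=
        Finset.sum_congr rfl fun y hy => by simp only [hRS y hy, if_false]
      rw [e1]
      have hload := hR.load a haR
      have hle : ∑ y ∈ S, (if ψ a = (if y ∈ S then φ y else ψ y) then e a y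
          else if y ∈ S then f y a - p y a else o' a y)
          ≤ ∑ s ∈ S, if ψ a = φ s then q s a + 9 * (e s a - q s a) else f s a - p s a := by
        refine Finset.sum_le_sum fun y hy => ?_
        have hqe := hr.q_le y a
        simp only [hy, if_true]
        rw [H.mult_e.symm a y]
        split_ifs <;> omega
      cases hψ : ψ a
      · simp only [hψ, Bool.false_eq_true, if_false] at hload hle ⊢
        unfold left1 at hload
        have e2 : ∑ s ∈ S, (if false = φ s then q s a + 9 * (e s a - q s a) else f s a - p s a)
            = ∑ s ∈ S, if φ s then f s a - p s a else q s a + 9 * (e s a - q s a) :=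
          Finset.sum_congr rfl fun s _ => by cases φ s <;> simp
        rw [e2] at hle
        linarith
      · simp only [hψ, if_true] at hload hle ⊢
        unfold left2 at hload
        have e2 : ∑ s ∈ S, (if true = φ s then q s a + 9 * (e s a - q s a) else f s a - p s a)
            = ∑ s ∈ S, if φ s then q s a + 9 * (e s a - q s a) else f s a - p s a :=
          Finset.sum_congr rfl fun s _ => by cases φ s <;> simp
        rw [e2] at hle
        linarith

/-- A colored nonempty `S` leaves a set of low potential in the complement. -/
lemma MinCE.exists_left_pot_le (H : MinCE e f c1 c2 X) (hr : IsReserve e f p q) (hSX : S ⊆ X)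
    (hne : S.Nonempty) {φ : V → Bool} {o : V → V → ℤ} (hS : IsCol e f c1 c2 S φ o)
    (slack : ∀ s ∈ S, ∑ y ∈ S, (if φ s = φ y then e s y else o s y)
      + ∑ y ∈ X \ S, (p s y + q s y) ≤ if φ s then c2 s else c1 s) :
    ∃ A ⊆ X \ S, A.Nonempty ∧
      pot e f (left1 e f p q φ S c1) (left2 e f p q φ S c2) A ≤ -6 := by
  by_contra! hno
  obtain ⟨ψ, o', hR⟩ := H.minimal (X \ S) f _ _ (Finset.card_lt_card (Finset.sdiff_ssubset hSX hne))
    (H.valid.left hr φ S) (fun A hA hA' => by have := hno A hA hA'; omega)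
  obtain ⟨o'', hc⟩ := hS.union H.valid hr Finset.disjoint_sdiff slack hR
  rw [Finset.union_sdiff_of_subset hSX] at hc
  exact H.not_col ⟨_, _, hc⟩

/-- The gap inequality for a colored nonempty `S`. -/
lemma MinCE.exists_rho_union_le (H : MinCE e f c1 c2 X) (hr : IsReserve e f p q) (hSX : S ⊆ X)
    (hne : S.Nonempty) {φ : V → Bool} {o : V → V → ℤ} (hS : IsCol e f c1 c2 S φ o)
    (slack : ∀ s ∈ S, ∑ y ∈ S, (if φ s = φ y then e s y else o s y)
      + ∑ y ∈ X \ S, (p s y + q s y) ≤ if φ s then c2 s else c1 s) :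
    ∃ A ⊆ X \ S, A.Nonempty ∧ rho e f c1 c2 (S ∪ A)
      + ∑ y ∈ A, ∑ s ∈ S, gain e f p q φ s y ≤ rho e f c1 c2 S - 3 := by
  obtain ⟨A, hA, hAne, hpot⟩ := H.exists_left_pot_le hr hSX hne hS slack
  refine ⟨A, hA, hAne, ?_⟩
  have h1 := H.valid.rho_union_le hr φ (S := S) (A := A)
    (Finset.disjoint_of_subset_right hA Finset.disjoint_sdiff)
  have h2 := penalty_le (c2 := left2 e f p q φ S c2) A
  unfold pot at hpot
  linarith

end Union

section Gap

variable {V : Type*} {e f p q : V → V → ℤ} {c1 c2 : V → ℤ} {X S R : Finset V}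

lemma MinCE.rho_ge (H : MinCE e f c1 c2 X) {A : Finset V} (hA : A ⊆ X) (hne : A.Nonempty) :
    -5 ≤ rho e f c1 c2 A := by
  have := H.pot_ge A hA hne
  have := penalty_nonneg (c2 := c2) A
  unfold pot at *
  linarith

lemma MinCE.nonempty (H : MinCE e f c1 c2 X) : X.Nonempty := by
  by_contra h
  rw [Finset.not_nonempty_iff_eq_empty] at h
  subst h
  exact H.not_col ⟨fun _ => true, fun _ _ => 0, ⟨fun _ _ => le_rfl, by simp, by simp⟩⟩

variable [DecidableEq V]

/-- The gap inequality with loads `r` reserved at a vertex `s` of the second color. -/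
lemma MinCE.exists_rho_union_add_le (H : MinCE e f c1 c2 X) (hSX : S ⊆ X)
    {φ : V → Bool} {o : V → V → ℤ} (hS : IsCol e f c1 c2 S φ o) {s : V} (hs : s ∈ S)
    (hφ : φ s = true) {r : V → ℤ} (hr : ∀ y, 0 ≤ r y ∧ r y ≤ e s y + f s y)
    (hload : ∑ y ∈ S, (if φ s = φ y then e s y else o s y) + ∑ y ∈ X \ S, r y ≤ c2 s) :
    ∃ A ⊆ X \ S, A.Nonempty ∧
      rho e f c1 c2 (S ∪ A) + 4 * ∑ y ∈ A, r y ≤ rho e f c1 c2 S - 3 := by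
  have hf := H.valid.mult_f.nonneg
  have he := H.valid.mult_e.nonneg
  have hpq : IsReserve e f (fun x y => if x = s then min (r y) (f s y) else 0)
      (fun x y => if x = s then r y - min (r y) (f s y) else 0) := by
    constructor
    · intro x y
      have := hf x y; have := hr y; have := hf s y
      split_ifs <;> omega
    · intro x y
      have := hf x y; have := hr y
      split_ifs with h
      · subst h; omega
      · omega
    · intro x y
      have := he x y; have := hr y; have := hf s y
      split_ifs <;> omega
    · intro x y
      have := he x y; have := hr y
      split_ifs with h
      · subst h; omega
      · omega
  obtain ⟨A, hA, hne, hle⟩ := H.exists_rho_union_le hpq hSX ⟨s, hs⟩ hS (by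
    intro x hx
    by_cases h : x = s
    · subst h
      simp only [if_true, hφ]
      refine le_trans (le_of_eq ?_) (hφ ▸ hload)
      congr 1
      exact Finset.sum_congr rfl fun y _ => by ring
    · simpa [h] using hS.load x hx)
  refine ⟨A, hA, hne, ?_⟩
  have h4 : 4 * ∑ y ∈ A, r y ≤ ∑ y ∈ A, ∑ x ∈ S, gain e f
      (fun x y => if x = s then min (r y) (f s y) else 0)
      (fun x y => if x = s then r y - min (r y) (f s y) else 0) φ x y := by
    rw [Finset.mul_sum]
    refine Finset.sum_le_sum fun y _ => ?_
    refine le_trans ?_ (Finset.single_le_sum (fun x _ => hpq.gain_nonneg φ x y) hs)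
    have := hr y
    simp only [gain, hφ, if_true]
    omega
  linarith

/-- A proper subset can be colored so that a prescribed vertex is of the first color
or keeps some spare capacity. -/
lemma MinCE.exists_col_spare (H : MinCE e f c1 c2 X) (hSX : S ⊂ X) (s : V)
    (budget : ∀ A ⊆ S, A.Nonempty → -2 ≤ pot e f c1 c2 A) :
    ∃ φ o, IsCol e f c1 c2 S φ o ∧ (s ∈ S → φ s = true →
      ∑ y ∈ S, (if φ s = φ y then e s y else o s y) + 1 ≤ c2 s) := by
  have hle : ∀ x, c2 x - (if x = s then 1 else 0) ≤ c2 x := fun x => by split_ifs <;> omega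
  obtain ⟨φ, o, hc⟩ := H.minimal S f c1 (fun x => c2 x - if x = s then 1 else 0)
    (Finset.card_lt_card hSX) (H.valid.mono (fun _ => le_rfl) hle) (by
      intro A hA hne
      have h1 := budget A hA hne
      have h2 := pot_sub_cost_le (e := e) (f := f) (c1 := c1) (c2 := c2) (c1' := c1)
        (c2' := fun x => c2 x - if x = s then 1 else 0) (δ1 := fun _ => 0)
        (δ2 := fun x => if x = s then 1 else 0) (A := A) (fun _ _ => le_rfl)
        (fun x _ => by split_ifs <;> omega) (fun x _ => by simp) (fun x _ => le_rfl)
      have h3 : ∑ x ∈ A, (4 * (0 : ℤ) + 3 * if x = s then 1 else 0) ≤ 3 := by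
        simp only [mul_ite, mul_one, mul_zero, zero_add, Finset.sum_ite_eq']
        split_ifs <;> omega
      linarith)
  refine ⟨φ, o, hc.congr_caps (fun _ _ => le_rfl) (fun x _ => hle x), fun hs hφ => ?_⟩
  have := hc.load s hs
  rw [hφ] at this
  simp only [if_true] at this
  rw [hφ]
  linarith

/-- Among the nonempty proper subsets below a bound there is one of smallest excess. -/
lemma exists_rho_min (e f : V → V → ℤ) (c1 c2 : V → ℤ) (hSX : S ⊂ X) (hS : S.Nonempty) :
    ∃ T ⊂ X, T.Nonempty ∧ rho e f c1 c2 T ≤ rho e f c1 c2 S ∧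
      ∀ A ⊂ X, A.Nonempty → rho e f c1 c2 T ≤ rho e f c1 c2 A := by
  obtain ⟨T, hT, hmin⟩ := Finset.exists_min_image (X.ssubsets.filter fun A => A.Nonempty)
    (rho e f c1 c2) ⟨S, by simp [hSX, hS]⟩
  simp only [Finset.mem_filter, Finset.mem_ssubsets, and_imp] at hT hmin
  exact ⟨T, hT.1, hT.2, hmin S hSX hS, hmin⟩

lemma MinCE.rho_add_three_le (H : MinCE e f c1 c2 X) (hSX : S ⊂ X) (hS : S.Nonempty) :
    rho e f c1 c2 X + 3 ≤ rho e f c1 c2 S := by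
  obtain ⟨T, hTX, hT, hTS, hmin⟩ := exists_rho_min e f c1 c2 hSX hS
  obtain ⟨φ, o, hc⟩ := H.minimal T f c1 c2 (Finset.card_lt_card hTX) H.valid
    (fun A hA hne => H.pot_ge A (hA.trans hTX.1) hne)
  have h0 := H.valid.isReserve_zero
  obtain ⟨A, hA, hAne, hle⟩ := H.exists_rho_union_le h0 hTX.1 hT hc hc.slack_zero
  have hg : 0 ≤ ∑ y ∈ A, ∑ s ∈ T, gain e f 0 0 φ s y :=
    Finset.sum_nonneg fun y _ => Finset.sum_nonneg fun s _ => h0.gain_nonneg φ s y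
  have hsub : T ∪ A ⊆ X := Finset.union_subset hTX.1 (hA.trans Finset.sdiff_subset)
  rcases hsub.eq_or_ssubset with heq | hss
  · rw [heq] at hle
    linarith
  · have := hmin _ hss (hT.mono Finset.subset_union_left)
    linarith

lemma MinCE.rho_add_four_le (H : MinCE e f c1 c2 X) (hSX : S ⊂ X) (hS : S.Nonempty) :
    rho e f c1 c2 X + 4 ≤ rho e f c1 c2 S := by
  obtain ⟨T, hTX, hT, hTS, hmin⟩ := exists_rho_min e f c1 c2 hSX hS
  by_contra hlt
  have hX5 := H.rho_ge subset_rfl H.nonempty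
  have hT3 := H.rho_add_three_le hTX hT
  by_cases hedge : ∃ s ∈ T, ∃ y ∈ X \ T, 1 ≤ e s y + f s y
  · obtain ⟨s, hs, y, hy, hsy⟩ := hedge
    have hfin : ∀ A ⊆ X \ T, A.Nonempty → ∀ g : ℤ, 0 ≤ g → (y ∈ A → 1 ≤ g) →
        ¬ rho e f c1 c2 (T ∪ A) + g ≤ rho e f c1 c2 T - 3 := by
      intro A hA hAne g hg0 hg hle
      have hsub : T ∪ A ⊆ X := Finset.union_subset hTX.1 (hA.trans Finset.sdiff_subset)
      rcases hsub.eq_or_ssubset with heq | hss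
      · rw [heq] at hle
        have hyA : y ∈ A := by
          rw [← heq] at hy
          simp only [Finset.mem_sdiff, Finset.mem_union] at hy
          tauto
        have := hg hyA
        omega
      · have := hmin _ hss (hT.mono Finset.subset_union_left)
        linarith
    obtain ⟨φ, o, hc, hsp⟩ := H.exists_col_spare hTX s (by
      intro A hA hne
      have hAX : A ⊂ X := lt_of_le_of_lt hA hTX
      have h1 := H.rho_add_three_le hAX hne
      have h2 := penalty_mono (c2 := c2) hAX.1
      have h3 := H.pot_ge X subset_rfl H.nonempty
      unfold pot at *
      linarith)
    cases hφ : φ s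
    · have h0 := H.valid.isReserve_zero
      obtain ⟨A, hA, hAne, hle⟩ := H.exists_rho_union_le h0 hTX.1 hT hc hc.slack_zero
      have hn : ∀ y ∈ A, 0 ≤ ∑ s ∈ T, gain e f 0 0 φ s y :=
        fun y _ => Finset.sum_nonneg fun s _ => h0.gain_nonneg φ s y
      refine hfin A hA hAne _ (Finset.sum_nonneg hn) (fun hyA => ?_) hle
      refine le_trans ?_ (Finset.single_le_sum hn hyA)
      refine le_trans ?_ (Finset.single_le_sum (fun s _ => h0.gain_nonneg φ s y) hs)
      simpa [gain, hφ] using hsy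
    · obtain ⟨A, hA, hAne, hle⟩ := H.exists_rho_union_add_le hTX.1 hc hs hφ
        (r := fun z => if z = y then 1 else 0) (by
          intro z
          have := H.valid.mult_e.nonneg s z
          have := H.valid.mult_f.nonneg s z
          split_ifs with h
          · subst h; omega
          · omega) (by
          have := hsp hs hφ
          simpa [hy] using this)
      refine hfin A hA hAne _ ?_ (fun hyA => ?_) hle
      · simp only [Finset.sum_ite_eq']
        split_ifs <;> norm_num
      · simp [hyA]
  · push Not at hedge
    have h1 := rho_union H.valid (A := T) (B := X \ T) Finset.disjoint_sdiff
    have h2 : ∑ y ∈ X \ T, ∑ x ∈ T, (9 * e x y + 4 * f x y) = 0 :=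
      Finset.sum_eq_zero fun y hy => Finset.sum_eq_zero fun x hx => by
        have := hedge x hx y hy
        have := H.valid.mult_e.nonneg x y
        have := H.valid.mult_f.nonneg x y
        omega
    rw [h2, Finset.union_sdiff_of_subset hTX.1] at h1
    have h3 := H.rho_add_three_le (Finset.sdiff_ssubset hTX.1 hT)
      (Finset.sdiff_nonempty.mpr fun h => hTX.2 h)
    omega

lemma MinCE.pot_ge_of_ssubset (H : MinCE e f c1 c2 X) {A : Finset V} (hAX : A ⊂ X)
    (hA : A.Nonempty) : -1 ≤ pot e f c1 c2 A := by
  have h1 := H.rho_add_four_le hAX hA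
  have h2 := penalty_mono (c2 := c2) hAX.1
  have h3 := H.pot_ge X subset_rfl H.nonempty
  unfold pot at *
  linarith

/-- Adding a vertex of the first color to a coloring of the rest: `g1`, `g2` are the edges
that may load it. -/
lemma MinCE.extend_first (H : MinCE e f c1 c2 X) {x : V} (hx : x ∈ X) (g1 g2 : V → ℤ)
    (h1 : ∀ y, 0 ≤ g1 y ∧ g1 y ≤ e x y) (h2 : ∀ y, 0 ≤ g2 y ∧ g2 y ≤ f x y)
    (hsum : ∑ y ∈ X.erase x, g1 y + ∑ y ∈ X.erase x, g2 y ≤ c1 x)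
    (budget : ∀ A ⊆ X.erase x, A.Nonempty → 8 * ∑ y ∈ A, e x y - 4 * ∑ y ∈ A, g1 y
      + 3 * ∑ y ∈ A, f x y - 3 * ∑ y ∈ A, g2 y ≤ pot e f c1 c2 A + 5) : False := by
  refine H.extend hx (fun y => 2 * e x y - g1 y) (fun y => f x y - g2 y)
    (fun y => by have := h1 y; omega) (fun y => by have := h2 y; omega) ?_ ?_
  · intro A hA hne
    refine le_trans (le_of_eq ?_) (budget A hA hne)
    simp only [mul_sub, Finset.sum_add_distrib, Finset.sum_sub_distrib, ← Finset.mul_sum]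
    ring
  · intro φ hφ
    refine ⟨false, fun y => f x y - g2 y,
      fun y => ⟨sub_nonneg.mpr (h2 y).2, sub_le_self _ (h2 y).1⟩, ?_, ?_⟩
    · simp only [Bool.false_eq_true, if_false]
      refine le_trans ?_ hsum
      rw [← Finset.sum_add_distrib]
      refine Finset.sum_le_sum fun y hy => ?_
      change (if false = φ y then e x y else f x y - (f x y - g2 y)) ≤ g1 y + g2 y
      have := h1 y; have := h2 y; have := H.valid.c1_le y; have := hφ y hy
      cases hy : φ y <;> simp only [hy, Bool.false_eq_true, if_false, if_true] at * <;> omega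
    · intro y hy
      change (if false = φ y then e x y else f x y - g2 y) ≤
        if φ y then f x y - g2 y else 2 * e x y - g1 y
      have := h1 y; have := h2 y
      cases hy : φ y <;> simp only [Bool.false_eq_true, if_false, if_true] <;> omega

/-- In a minimal counterexample every vertex can use the second color. -/
lemma MinCE.c2_nonneg (H : MinCE e f c1 c2 X) {x : V} (hx : x ∈ X) : 0 ≤ c2 x := by
  by_contra! hneg
  have he := H.valid.mult_e.nonneg
  have hf := H.valid.mult_f.nonneg
  have hc0 : 0 ≤ c1 x := by
    by_contra! hc
    have h1 := H.pot_ge {x} (by simpa using hx) ⟨x, by simp⟩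
    rw [pot, rho_singleton H.valid, penalty_eq_three (Finset.mem_singleton_self x) hneg] at h1
    unfold weight at h1
    omega
  have hw : weight (c1 x) (c2 x) = 1 + 4 * c1 x := by unfold weight; omega
  have hpot : ∀ A ⊆ X.erase x, pot e f c1 c2 (insert x A) ≤ pot e f c1 c2 A + (1 + 4 * c1 x)
      - 9 * ∑ y ∈ A, e x y - 4 * ∑ y ∈ A, f x y := by
    intro A hA
    have hxA : x ∉ A := fun h => by simpa using hA h
    have h1 := rho_insert H.valid hxA
    have h2 := penalty_le (c2 := c2) A
    have h3 := penalty_eq_three (Finset.mem_insert_self x A) hneg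
    unfold pot
    linarith
  have hins : ∀ A ⊆ X.erase x, insert x A ⊆ X := fun A hA =>
    Finset.insert_subset hx (hA.trans (Finset.erase_subset _ _))
  have hsa : ∀ A : Finset V, 0 ≤ ∑ y ∈ A, e x y := fun A => Finset.sum_nonneg fun y _ => he x y
  have hsk : ∀ A : Finset V, 0 ≤ ∑ y ∈ A, f x y := fun A => Finset.sum_nonneg fun y _ => hf x y
  have hwhole : ∀ A ⊆ X.erase x, insert x A = X → A = X.erase x := by
    intro A hA h
    rw [← h, Finset.erase_insert fun h => by simpa using hA h]
  by_cases hz : c1 x = 0 ∨ (∑ y ∈ X.erase x, e x y = 0 ∧ ∑ y ∈ X.erase x, f x y = 0)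
  · refine H.extend_first hx 0 0 (fun y => ⟨le_rfl, he x y⟩) (fun y => ⟨le_rfl, hf x y⟩)
      (by simpa using hc0) fun A hA hne => ?_
    have h1 := hpot A hA
    have h2 := H.pot_ge _ (hins A hA) (Finset.insert_nonempty x A)
    have h3 := H.pot_ge A (hA.trans (Finset.erase_subset _ _)) hne
    have h4 := hsa A
    have h5 := hsk A
    simp only [Pi.zero_apply, Finset.sum_const_zero]
    rcases hz with hz | ⟨hz1, hz2⟩
    · omega
    · have h6 := Finset.sum_le_sum_of_subset_of_nonneg hA fun y _ _ => he x y
      have h7 := Finset.sum_le_sum_of_subset_of_nonneg hA fun y _ _ => hf x y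
      omega
  · push Not at hz
    have hc1 : c1 x = 1 := by have := H.valid.c1_le x; omega
    by_cases ht : ∃ y1 ∈ X.erase x, 1 ≤ f x y1
    · obtain ⟨y1, hy1, hfy1⟩ := ht
      refine H.extend_first hx 0 (fun y => if y = y1 then 1 else 0) (fun y => ⟨le_rfl, he x y⟩)
        (fun y => ?_) (by simp [hc1, hy1]) fun A hA hne => ?_
      · have := hf x y
        split_ifs with h
        · subst h; omega
        · omega
      have h1 := hpot A hA
      have h2 := H.pot_ge _ (hins A hA) (Finset.insert_nonempty x A)
      have h3 := H.pot_ge A (hA.trans (Finset.erase_subset _ _)) hne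
      have h4 := hsa A
      have h5 := hsk A
      simp only [Pi.zero_apply, Finset.sum_const_zero, Finset.sum_ite_eq']
      rcases (hins A hA).eq_or_ssubset with heq | hss
      · obtain rfl := hwhole A hA heq
        simp only [hy1, if_true]
        have h8 := Finset.single_le_sum (fun y _ => hf x y) hy1
        omega
      · have h6 := H.pot_ge_of_ssubset hss (Finset.insert_nonempty x A)
        have h7 : (0 : ℤ) ≤ if y1 ∈ A then 1 else 0 := by split_ifs <;> omega
        omega
    · push Not at ht
      have ht0 : ∑ y ∈ X.erase x, f x y = 0 := Finset.sum_eq_zero fun y hy => by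
        have := ht y hy; have := hf x y; omega
      obtain ⟨z1, hz1, hez1⟩ : ∃ z ∈ X.erase x, e x z ≠ 0 := by
        by_contra! h
        exact hz.2 (Finset.sum_eq_zero h) ht0
      have hez : 1 ≤ e x z1 := by have := he x z1; omega
      refine H.extend_first hx (fun y => if y = z1 then 1 else 0) 0 (fun y => ?_)
        (fun y => ⟨le_rfl, hf x y⟩) (by simp [hc1, hz1]) fun A hA hne => ?_
      · have := he x y
        split_ifs with h
        · subst h; omega
        · omega
      have h1 := hpot A hA
      have h2 := H.pot_ge _ (hins A hA) (Finset.insert_nonempty x A)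
      have h3 := H.pot_ge A (hA.trans (Finset.erase_subset _ _)) hne
      have h4 := hsa A
      have h5 := hsk A
      have h9 := Finset.sum_le_sum_of_subset_of_nonneg hA fun y _ _ => hf x y
      simp only [Pi.zero_apply, Finset.sum_const_zero, Finset.sum_ite_eq']
      rcases (hins A hA).eq_or_ssubset with heq | hss
      · obtain rfl := hwhole A hA heq
        simp only [hz1, if_true]
        have h8 := Finset.single_le_sum (fun y _ => he x y) hz1
        omega
      · have h6 := H.pot_ge_of_ssubset hss (Finset.insert_nonempty x A)
        have h7 : (0 : ℤ) ≤ if z1 ∈ A then 1 else 0 := by split_ifs <;> omega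
        omega

end Gap

section Subdivision

variable {V : Type*} {e f : V → V → ℤ} {c1 c2 : V → ℤ} {X : Finset V}

lemma MinCE.pot_eq (H : MinCE e f c1 c2 X) {A : Finset V} (hA : A ⊆ X) :
    pot e f c1 c2 A = rho e f c1 c2 A := by
  classical exact pot_eq_rho fun _ hx => H.c2_nonneg (hA hx)

lemma MinCE.weight_le (H : MinCE e f c1 c2 X) (x : V) : weight (c1 x) (c2 x) ≤ 14 := by
  have := H.valid.c1_le x
  have := H.valid.c2_le x
  unfold weight
  omega

variable [DecidableEq V]

lemma MinCE.rho_ge_of_ssubset (H : MinCE e f c1 c2 X) {A : Finset V} (hAX : A ⊂ X)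
    (hA : A.Nonempty) : -1 ≤ rho e f c1 c2 A := by
  rw [← H.pot_eq hAX.1]
  exact H.pot_ge_of_ssubset hAX hA

lemma IsMult.sum_erase {g : V → V → ℤ} (hg : IsMult g) (x : V) (X : Finset V) :
    ∑ y ∈ X.erase x, g x y = ∑ y ∈ X, g x y :=
  Finset.sum_erase X (hg.irrefl x)

/-- Lower bounds for the excess of a set avoiding `x`, through the set enlarged by `x`. -/
lemma MinCE.rho_of_subset_erase (H : MinCE e f c1 c2 X) {x : V} (hx : x ∈ X) {A : Finset V}
    (hA : A ⊆ X.erase x) :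
    (A = X.erase x ∧ -5 - weight (c1 x) (c2 x) + 9 * ∑ y ∈ X, e x y + 4 * ∑ y ∈ X, f x y
      ≤ rho e f c1 c2 A) ∨
    (insert x A ⊂ X ∧ -1 - weight (c1 x) (c2 x) + 9 * ∑ y ∈ A, e x y + 4 * ∑ y ∈ A, f x y
      ≤ rho e f c1 c2 A) := by
  have hxA : x ∉ A := fun h => by simpa using hA h
  have h1 := rho_insert H.valid hxA
  have hsub : insert x A ⊆ X := Finset.insert_subset hx (hA.trans (Finset.erase_subset _ _))
  rcases hsub.eq_or_ssubset with heq | hss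
  · left
    obtain rfl : A = X.erase x := by rw [← heq, Finset.erase_insert hxA]
    have h2 := H.rho_ge subset_rfl H.nonempty
    rw [heq, H.valid.mult_e.sum_erase, H.valid.mult_f.sum_erase] at h1
    exact ⟨rfl, by linarith⟩
  · right
    have h2 := H.rho_ge_of_ssubset hss (Finset.insert_nonempty x A)
    exact ⟨hss, by linarith⟩

/-- The excess after adding one weak edge. -/
lemma Valid.rho_add_edge (H : Valid e f c1 c2) {f' : V → V → ℤ} (hf' : IsMult f') {z1 z2 : V}
    (hdef : ∀ a b, f' a b = f a b + (if a = z1 then if b = z2 then 1 else 0 else 0)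
      + (if a = z2 then if b = z1 then 1 else 0 else 0)) (A : Finset V) :
    rho e f' c1 c2 A = rho e f c1 c2 A - if z1 ∈ A ∧ z2 ∈ A then 4 else 0 := by
  have H' : Valid e f' c1 c2 := ⟨H.mult_e, H.e_le, hf', H.c1_le, H.c2_le⟩
  have h1 := two_mul_excess (w := fun x => weight (c1 x) (c2 x)) H.mult A
  have h2 := two_mul_excess (w := fun x => weight (c1 x) (c2 x)) H'.mult A
  have h3 : ∑ a ∈ A, ∑ b ∈ A, (9 * e a b + 4 * f' a b)
      = ∑ a ∈ A, ∑ b ∈ A, (9 * e a b + 4 * f a b)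
        + 2 * if z1 ∈ A ∧ z2 ∈ A then 4 else 0 := by
    have h4 : ∀ u v : V, ∑ a ∈ A, ∑ b ∈ A, (if a = u then if b = v then (1 : ℤ) else 0 else 0)
        = if u ∈ A ∧ v ∈ A then 1 else 0 := by
      intro u v
      by_cases hu : u ∈ A <;> by_cases hv : v ∈ A <;>
        simp [Finset.sum_ite_irrel, hu, hv]
    simp only [hdef, mul_add, Finset.sum_add_distrib, ← Finset.mul_sum, h4]
    by_cases hu : z1 ∈ A <;> by_cases hv : z2 ∈ A <;> (simp [hu, hv]; try ring)
  unfold rho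
  simp only [Finset.sum_sub_distrib] at h1 h2
  omega

/-- A vertex of full capacity is not of degree two with two strong edges. -/
lemma MinCE.not_subdivision (H : MinCE e f c1 c2 X) {x : V} (hx : x ∈ X) (h1 : c1 x = 1)
    (h2 : c2 x = 3) (hs : ∑ y ∈ X, e x y = 2) (ht : ∑ y ∈ X, f x y = 0) : False := by
  have he := H.valid.mult_e.nonneg
  have hf := H.valid.mult_f.nonneg
  obtain ⟨z1, hz1, hez1⟩ : ∃ z ∈ X, e x z ≠ 0 := by
    by_contra! h
    rw [Finset.sum_eq_zero h] at hs
    omega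
  have hez1' : e x z1 = 1 := by
    have := he x z1; have := H.valid.e_le x z1; omega
  have hs1 := Finset.add_sum_erase X (e x) hz1
  obtain ⟨z2, hz2, hez2⟩ : ∃ z ∈ X.erase z1, e x z ≠ 0 := by
    by_contra! h
    rw [Finset.sum_eq_zero h] at hs1
    omega
  have hez2' : e x z2 = 1 := by
    have := he x z2; have := H.valid.e_le x z2; omega
  have hs2 := Finset.add_sum_erase (X.erase z1) (e x) hz2
  have hez : ∀ y ∈ X, y ≠ z1 → y ≠ z2 → e x y = 0 := by
    intro y hy hy1 hy2
    have h3 : ∑ y ∈ (X.erase z1).erase z2, e x y = 0 := by omega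
    exact (Finset.sum_eq_zero_iff_of_nonneg fun y _ => he x y).mp h3 y (by simp [hy, hy1, hy2])
  have hfz : ∀ y ∈ X, f x y = 0 := (Finset.sum_eq_zero_iff_of_nonneg fun y _ => hf x y).mp ht
  have hz12 : z2 ≠ z1 := Finset.ne_of_mem_erase hz2
  have hz1x : z1 ≠ x := by rintro rfl; rw [H.valid.mult_e.irrefl] at hez1'; omega
  have hz2x : z2 ≠ x := by rintro rfl; rw [H.valid.mult_e.irrefl] at hez2'; omega
  have hz2X := Finset.mem_of_mem_erase hz2
  obtain ⟨f', hdef⟩ : ∃ f' : V → V → ℤ, ∀ a b, f' a b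
      = f a b + (if a = z1 then if b = z2 then 1 else 0 else 0)
        + (if a = z2 then if b = z1 then 1 else 0 else 0) := ⟨_, fun _ _ => rfl⟩
  have hf' : IsMult f' := by
    constructor
    · intro a b
      rw [hdef, hdef, H.valid.mult_f.symm a b]
      split_ifs <;> omega
    · intro a b
      rw [hdef]
      have := hf a b
      split_ifs <;> omega
    · intro a
      rw [hdef, H.valid.mult_f.irrefl]
      by_cases h : a = z1
      · subst h; simp [hz12.symm]
      · by_cases h' : a = z2
        · subst h'; simp [h]
        · simp [h, h']
  have hff' : ∀ a b, f a b ≤ f' a b := by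
    intro a b
    rw [hdef]
    split_ifs <;> omega
  obtain ⟨φ, o, hc⟩ := H.minimal (X.erase x) f' c1 c2 (Finset.card_erase_lt_of_mem hx)
    ⟨H.valid.mult_e, H.valid.e_le, hf', H.valid.c1_le, H.valid.c2_le⟩ (by
      intro A hA hne
      have hAX := hA.trans (Finset.erase_subset _ _)
      rw [pot_eq_rho fun y hy => H.c2_nonneg (hAX hy), H.valid.rho_add_edge hf' hdef]
      split_ifs with h
      · have hxA : x ∉ A := fun h => by simpa using hA h
        have e1 := rho_insert H.valid hxA
        have e2 := H.rho_ge (Finset.insert_subset hx hAX) (Finset.insert_nonempty x A)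
        have e3 : 2 ≤ ∑ y ∈ A, e x y := by
          have h3 := Finset.add_sum_erase A (e x) h.1
          have h4 := Finset.single_le_sum (fun y _ => he x y)
            (Finset.mem_erase.mpr ⟨hz12, h.2⟩)
          omega
        have e4 : 0 ≤ ∑ y ∈ A, f x y := Finset.sum_nonneg fun y _ => hf x y
        have := H.weight_le x
        omega
      · have := H.rho_ge hAX hne
        omega)
  have hcapx : ∀ i : Bool, 1 ≤ if i then c2 x else c1 x := by
    intro i
    split_ifs <;> omega
  have finish : ∀ u v : V, (u = z1 ∧ v = z2 ∨ u = z2 ∧ v = z1) → φ u ≠ φ v → 1 ≤ o u v →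
      False := by
    intro u v huv hφ ho
    have hvX : v ∈ X.erase x := by rcases huv with ⟨rfl, rfl⟩ | ⟨rfl, rfl⟩ <;> simp [*]
    have huX : u ∈ X.erase x := by rcases huv with ⟨rfl, rfl⟩ | ⟨rfl, rfl⟩ <;> simp [*]
    have hne : u ≠ v := fun h => hφ (congrArg φ h)
    have heu : e x u = 1 := by rcases huv with ⟨rfl, rfl⟩ | ⟨rfl, rfl⟩ <;> assumption
    have hezz : ∀ y ∈ X, y ≠ u → y ≠ v → e x y = 0 := by
      rcases huv with ⟨rfl, rfl⟩ | ⟨rfl, rfl⟩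
      · exact hez
      · exact fun y hy h3 h4 => hez y hy h4 h3
    have hfuv : f' u v = f u v + 1 ∧ f' v u = f v u + 1 := by
      rw [hdef, hdef]
      rcases huv with ⟨rfl, rfl⟩ | ⟨rfl, rfl⟩ <;> simp [hz12, hz12.symm]
    have hdefn : ∀ y ∈ X.erase x, φ u = φ y → e x y = if y = u then 1 else 0 := by
      intro y hy h
      by_cases hyu : y = u
      · rw [hyu, heu, if_pos rfl]
      · rw [if_neg hyu]
        exact hezz y (Finset.mem_of_mem_erase hy) hyu fun h' => hφ (h' ▸ h)
    refine H.not_col (H.valid.exists_isCol_insert (i := φ u) (p := 0) hx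
      (o := fun a b => o a b - if a = u then if b = v then 1 else 0 else 0) (φ := φ) ?_ ?_ ?_
      (fun y => ⟨le_rfl, hf x y⟩) ?_)
    · intro a b
      have := hc.nonneg a b
      by_cases ha : a = u
      · by_cases hb : b = v
        · subst ha hb; simpa using ho
        · simpa [ha, hb] using hc.nonneg u b
      · simpa [ha] using this
    · intro a ha b hb hab
      have h3 := hc.cover a ha b hb hab
      by_cases h4 : a = u ∧ b = v
      · obtain ⟨rfl, rfl⟩ := h4
        have := hfuv.1
        simp only [hne, hne.symm, if_true, if_false]
        omega
      · by_cases h5 : b = u ∧ a = v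
        · obtain ⟨rfl, rfl⟩ := h5
          have := hfuv.2
          simp only [hne, hne.symm, if_true, if_false]
          omega
        · have e1 : (if a = u then if b = v then (1 : ℤ) else 0 else 0) = 0 := by
            rw [← ite_and, if_neg h4]
          have e2 : (if b = u then if a = v then (1 : ℤ) else 0 else 0) = 0 := by
            rw [← ite_and, if_neg h5]
          simp only [e1, e2]
          have := hff' a b
          omega
    · intro a ha
      have h3 := hc.load a ha
      by_cases hau : a = u
      · subst hau
        refine le_trans (le_of_eq ?_) h3
        simp only [if_true, heu]
        rw [← Finset.add_sum_erase _ _ hvX, ← Finset.add_sum_erase (X.erase x)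
          (fun y => if φ a = φ y then e a y else o a y) hvX]
        simp only [hφ, if_true, if_false]
        have e1 : ∑ y ∈ (X.erase x).erase v, (if φ a = φ y then e a y
            else o a y - if y = v then 1 else 0)
            = ∑ y ∈ (X.erase x).erase v, if φ a = φ y then e a y else o a y :=
          Finset.sum_congr rfl fun y hy => by simp [Finset.ne_of_mem_erase hy]
        rw [e1]
        ring
      · refine le_trans (le_of_eq ?_) h3
        simp only [hau, if_false, sub_zero, Pi.zero_apply, add_eq_left]
        split_ifs with h4
        · rw [hdefn a ha h4, if_neg hau]
        · rfl
    · refine le_trans (le_trans (Finset.sum_le_sum (g := fun y => if y = u then 1 else 0)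
        fun y hy => ?_) ?_) (hcapx _)
      · split_ifs with h3 h4
        · subst h4; exact heu.le
        · rw [hdefn y hy h3, if_neg h4]
        · simp [hfz y (Finset.mem_of_mem_erase hy)]
        · simp [hfz y (Finset.mem_of_mem_erase hy)]
      · simp only [Finset.sum_ite_eq']
        split_ifs
        omega
  by_cases hφ : φ z1 = φ z2
  · have hezφ : ∀ y ∈ X.erase x, (!φ z1) = φ y → e x y = 0 := by
      intro y hy h
      refine hez y (Finset.mem_of_mem_erase hy) ?_ ?_
      · rintro rfl; simp at h
      · rintro rfl; rw [hφ] at h; simp at h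
    refine H.not_col (H.valid.exists_isCol_insert (i := !φ z1) (p := 0) hx hc.nonneg
      (fun a ha b hb hab => (hff' a b).trans (hc.cover a ha b hb hab)) (fun a ha => ?_)
      (fun y => ⟨le_rfl, hf x y⟩) ?_)
    · have h3 := hc.load a ha
      refine le_trans (le_of_eq ?_) h3
      rw [add_eq_left]
      split_ifs with h4
      · exact hezφ a ha h4
      · rfl
    · rw [Finset.sum_eq_zero]
      · have := hcapx (!φ z1); omega
      · intro y hy
        split_ifs with h3
        · exact hezφ y hy h3
        · simp [hfz y (Finset.mem_of_mem_erase hy)]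
  · have h3 := hc.cover z1 (by simp [hz1, hz1x]) z2 (by simp [hz2X, hz2x]) hφ
    have h4 : 1 ≤ f' z1 z2 := by
      rw [hdef]
      have := hf z1 z2
      simp only [if_true]
      split_ifs <;> omega
    by_cases h5 : 1 ≤ o z1 z2
    · exact finish z1 z2 (.inl ⟨rfl, rfl⟩) hφ h5
    · exact finish z2 z1 (.inr ⟨rfl, rfl⟩) (Ne.symm hφ) (by omega)

end Subdivision

section Degree

variable {V : Type*} {e f : V → V → ℤ} {c1 c2 : V → ℤ} {X : Finset V}

/-- The load counts of the two colors at `x` add up to the degree. -/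
lemma sum_true_add_sum_false (g h : V → ℤ) (φ : V → Bool) (Y : Finset V) :
    ∑ y ∈ Y, (if true = φ y then g y else h y) + ∑ y ∈ Y, (if false = φ y then g y else h y)
      = ∑ y ∈ Y, g y + ∑ y ∈ Y, h y := by
  rw [← Finset.sum_add_distrib, ← Finset.sum_add_distrib]
  refine Finset.sum_congr rfl fun y _ => ?_
  cases φ y <;> simp [add_comm]

variable [DecidableEq V]

lemma MinCE.pot_eq_of_subset_erase (H : MinCE e f c1 c2 X) {x : V} {A : Finset V}
    (hA : A ⊆ X.erase x) : pot e f c1 c2 A = rho e f c1 c2 A :=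
  H.pot_eq (hA.trans (Finset.erase_subset _ _))

/-- Degree bounds from removing a vertex and lowering `c2` on its strong neighbors. -/
lemma MinCE.degree_lower (H : MinCE e f c1 c2 X) {x : V} (hx : x ∈ X) :
    c2 x + 1 ≤ ∑ y ∈ X, e x y + ∑ y ∈ X, f x y ∧
      (0 ≤ c1 x → c2 x + 2 ≤ ∑ y ∈ X, e x y + ∑ y ∈ X, f x y) := by
  have he := H.valid.mult_e.nonneg
  have hf := H.valid.mult_f.nonneg
  by_contra hcon
  refine H.extend hx (fun _ => 0) (fun y => e x y) (fun _ => le_rfl) (he x) ?_ ?_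
  · intro A hA hne
    rw [H.pot_eq_of_subset_erase hA]
    simp only [mul_zero, zero_add, ← Finset.mul_sum]
    have h1 := H.rho_ge_of_ssubset (lt_of_le_of_lt hA (Finset.erase_ssubset hx)) hne
    have h2 := H.weight_le x
    have h3 : ∑ y ∈ A, e x y ≤ ∑ y ∈ X, e x y := Finset.sum_le_sum_of_subset_of_nonneg
      (hA.trans (Finset.erase_subset _ _)) fun y _ _ => he x y
    have h5 : 0 ≤ ∑ y ∈ A, f x y := Finset.sum_nonneg fun y _ => hf x y
    have h6 : 0 ≤ ∑ y ∈ X, f x y := Finset.sum_nonneg fun y _ => hf x y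
    by_cases ha : ∑ y ∈ A, e x y ≤ 1
    · omega
    rcases H.rho_of_subset_erase hx hA with ⟨rfl, h4⟩ | ⟨-, h4⟩
    · rw [H.valid.mult_e.sum_erase]
      by_contra hlt
      have hcc := H.valid.c1_le x
      have hcc2 := H.valid.c2_le x
      have hw : weight (c1 x) (c2 x) = 1 + 4 * max (c1 x) (-1) + 3 * max (c2 x) 0 := rfl
      exact H.not_subdivision hx (by omega) (by omega) (by omega) (by omega)
    · omega
  · intro φ _
    have hsum := sum_true_add_sum_false (e x) (f x) φ (X.erase x)
    rw [H.valid.mult_e.sum_erase, H.valid.mult_f.sum_erase] at hsum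
    have hn : ∀ i : Bool, ∀ y ∈ X.erase x, 0 ≤ if i = φ y then e x y else f x y := by
      intro i y _
      have := he x y; have := hf x y
      split_ifs <;> assumption
    by_cases h2 : ∑ y ∈ X.erase x, (if true = φ y then e x y else f x y) ≤ c2 x
    · refine ⟨true, 0, fun y => ⟨le_rfl, hf x y⟩, by simpa using h2, fun y _ => ?_⟩
      cases φ y <;> simp
    · have hF := Finset.sum_nonneg (hn false)
      have h0 : ∑ y ∈ X.erase x, (if false = φ y then e x y else f x y) = 0 ∧ 0 ≤ c1 x := by
        omega
      refine ⟨false, 0, fun y => ⟨le_rfl, hf x y⟩, by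
        simp only [Pi.zero_apply, sub_zero, Bool.false_eq_true, if_false]; omega, fun y hy => ?_⟩
      have h3 := (Finset.sum_eq_zero_iff_of_nonneg (hn false)).mp h0.1 y hy
      have := he x y
      cases hy : φ y <;> simp [hy] at h3 ⊢ <;> omega

lemma MinCE.weak_degree_lower (H : MinCE e f c1 c2 X) {x : V} (hx : x ∈ X) (h1 : c1 x = 1)
    (hs : ∑ y ∈ X, e x y = 0) : c2 x + 3 ≤ ∑ y ∈ X, f x y := by
  have he := H.valid.mult_e.nonneg
  have hf := H.valid.mult_f.nonneg
  by_contra hcon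
  have hez := (Finset.sum_eq_zero_iff_of_nonneg fun y _ => he x y).mp hs
  refine H.extend hx (fun _ => 0) (fun _ => 0) (fun _ => le_rfl) (fun _ => le_rfl) ?_ ?_
  · intro A hA hne
    have := H.pot_ge A (hA.trans (Finset.erase_subset _ _)) hne
    simpa using by omega
  · intro φ _
    have hsum := sum_true_add_sum_false (e x) (f x) φ (X.erase x)
    rw [H.valid.mult_e.sum_erase, H.valid.mult_f.sum_erase] at hsum
    have hx0 : ∀ i : Bool, ∀ y ∈ X.erase x, (if i = φ y then e x y else (0 : V → ℤ) y)
        ≤ if φ y then (0 : ℤ) else 0 := by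
      intro i y hy
      have := hez y (Finset.mem_of_mem_erase hy)
      simp [this]
    by_cases h2 : ∑ y ∈ X.erase x, (if true = φ y then e x y else f x y) ≤ c2 x
    · exact ⟨true, 0, fun y => ⟨le_rfl, hf x y⟩, by simpa using h2, hx0 true⟩
    · exact ⟨false, 0, fun y => ⟨le_rfl, hf x y⟩, by
        simp only [Pi.zero_apply, sub_zero, Bool.false_eq_true, if_false]; omega, hx0 false⟩

end Degree

section ProperSubset

variable {V : Type*} {e f : V → V → ℤ} {c1 c2 : V → ℤ} {X : Finset V} [DecidableEq V]

/-- Two units of a nonnegative function of sum at least two. -/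
lemma exists_two_units {g : V → ℤ} (hg : ∀ y, 0 ≤ g y) {R : Finset V} (h : 2 ≤ ∑ y ∈ R, g y) :
    ∃ y1 ∈ R, ∃ y2 ∈ R, ∀ y,
      (if y = y1 then 1 else 0) + (if y = y2 then 1 else 0) ≤ g y := by
  obtain ⟨y1, hy1, h1⟩ : ∃ y ∈ R, 0 < g y := by
    by_contra! hno
    have := Finset.sum_nonpos hno
    omega
  obtain ⟨y2, hy2, h2⟩ : ∃ y ∈ R, 0 < g y - if y = y1 then 1 else 0 := by
    by_contra! hno
    have := Finset.sum_nonpos hno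
    rw [Finset.sum_sub_distrib, Finset.sum_ite_eq', if_pos hy1] at this
    omega
  refine ⟨y1, hy1, y2, hy2, fun y => ?_⟩
  have := hg y
  by_cases h3 : y = y1
  · subst h3
    by_cases h4 : y = y2
    · subst h4; simp only [if_true] at *; omega
    · simp only [if_true, h4, if_false]; omega
  · by_cases h4 : y = y2
    · subst h4; simp only [h3, if_true, if_false] at *; omega
    · simpa [h3, h4] using this

/-- Extending a coloring of `M` to `B` such that `u` gets the second color and spare capacity. -/
lemma MinCE.exists_col_union_spare (H : MinCE e f c1 c2 X) {M B : Finset V} {φ : V → Bool}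
    {o : V → V → ℤ} (hM : IsCol e f c1 c2 M φ o) (hd : Disjoint M B) (hB : B.card < X.card)
    {u : V} (hu : u ∈ B) {k : ℤ} (hk : 0 ≤ k) (hu1 : left1 e f 0 0 φ M c1 u < 0)
    (budget : ∀ A ⊆ B, A.Nonempty → -5 ≤ pot e f (left1 e f 0 0 φ M c1)
      (fun y => left2 e f 0 0 φ M c2 y - if y = u then k else 0) A) :
    ∃ ψ o', IsCol e f c1 c2 (M ∪ B) ψ o' ∧ ψ u = true ∧
      ∑ y ∈ M ∪ B, (if ψ u = ψ y then e u y else o' u y) + k ≤ c2 u := by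
  have h0 := H.valid.isReserve_zero
  have hle : ∀ (c : V → ℤ) (x : V), c x - (if x = u then k else 0) ≤ c x := fun c x => by
    split_ifs <;> omega
  have huM : u ∉ M := fun h => Finset.disjoint_left.mp hd h hu
  obtain ⟨ψ, o', hR⟩ := H.minimal B f _ _ hB ((H.valid.left h0 φ M).mono (fun _ => le_rfl)
    (hle (left2 e f 0 0 φ M c2))) budget
  have V' := H.valid.mono (c1' := c1) (c2' := fun x => c2 x - if x = u then k else 0)
    (fun _ => le_rfl) (hle c2)
  have hM' : IsCol e f c1 (fun x => c2 x - if x = u then k else 0) M φ o :=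
    hM.congr_caps (fun _ _ => le_rfl) fun x hx => by
      have : x ≠ u := fun h => huM (h ▸ hx)
      simp [this]
  have hR' : IsCol e f (left1 e f 0 0 φ M c1)
      (left2 e f 0 0 φ M (fun x => c2 x - if x = u then k else 0)) B ψ o' :=
    hR.congr_caps (fun _ _ => le_rfl) fun x _ => le_of_eq (by unfold left2; ring)
  obtain ⟨o'', hc⟩ := hM'.union V' h0 hd hM'.slack_zero hR'
  have hψ : ψ u = true := by
    have := hR.load_nonneg H.valid hu
    by_contra h
    rw [Bool.not_eq_true] at h
    rw [h] at this
    simp only [Bool.false_eq_true, if_false] at this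
    omega
  refine ⟨_, _, hc.congr_caps (fun _ _ => le_rfl) (fun x _ => hle c2 x), by simp [huM, hψ], ?_⟩
  have := hc.load u (Finset.mem_union_right _ hu)
  simp only [huM, hψ, if_true, if_false] at this ⊢
  linarith

/-- A tight proper subset has a strong edge to its complement. -/
lemma MinCE.exists_strong_edge (H : MinCE e f c1 c2 X) {M : Finset V} (hMX : M ⊂ X)
    (hM : M.Nonempty) (hrho : rho e f c1 c2 M = -1) :
    ∃ s ∈ M, ∃ u ∈ X \ M, e s u = 1 := by
  by_contra! hno
  have he0 : ∀ s ∈ M, ∀ u ∈ X \ M, e s u = 0 := fun s hs u hu => by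
    have := hno s hs u hu
    have := H.valid.mult_e.nonneg s u
    have := H.valid.e_le s u
    omega
  have hf := H.valid.mult_f.nonneg
  obtain ⟨φ, o, hc⟩ := H.minimal M f c1 c2 (Finset.card_lt_card hMX) H.valid
    fun A hA hne => H.pot_ge A (hA.trans hMX.1) hne
  obtain ⟨A, hA, hne, hle⟩ :=
    H.exists_left_pot_le H.valid.isReserve_zero hMX.1 hM hc hc.slack_zero
  have hd : Disjoint M A := Finset.disjoint_of_subset_right hA Finset.disjoint_sdiff
  have h1 := pot_sub_cost_le (e := e) (f := f) (c1 := c1) (c2 := c2)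
    (c1' := left1 e f 0 0 φ M c1) (c2' := left2 e f 0 0 φ M c2)
    (δ1 := fun y => ∑ s ∈ M, if φ s then f s y else 0)
    (δ2 := fun y => ∑ s ∈ M, if φ s then 0 else f s y) (A := A)
    (fun y _ => Finset.sum_nonneg fun s _ => by split_ifs <;> simp [hf])
    (fun y _ => Finset.sum_nonneg fun s _ => by split_ifs <;> simp [hf])
    (fun y hy => by
      unfold left1
      refine le_of_eq (congrArg _ (Finset.sum_congr rfl fun s hs => ?_))
      simp [he0 s hs y (hA hy)])
    (fun y hy => by
      unfold left2
      refine le_of_eq (congrArg _ (Finset.sum_congr rfl fun s hs => ?_))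
      simp [he0 s hs y (hA hy)])
  have hAX : A ⊆ X := hA.trans Finset.sdiff_subset
  rw [H.pot_eq hAX] at h1
  have h2 := rho_union H.valid hd
  have h3 : ∑ y ∈ A, (4 * ∑ s ∈ M, (if φ s then f s y else 0)
      + 3 * ∑ s ∈ M, if φ s then 0 else f s y)
      ≤ ∑ y ∈ A, ∑ s ∈ M, (9 * e s y + 4 * f s y) := by
    refine Finset.sum_le_sum fun y hy => ?_
    rw [Finset.mul_sum, Finset.mul_sum, ← Finset.sum_add_distrib]
    refine Finset.sum_le_sum fun s hs => ?_
    have := hf s y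
    rw [he0 s hs y (hA hy)]
    split_ifs <;> omega
  have h4 := H.rho_ge (Finset.union_subset hMX.1 hAX) (hM.mono Finset.subset_union_left)
  linarith

/-- Proper nonempty subsets of a minimal counterexample have nonnegative excess. -/
lemma MinCE.rho_nonneg (H : MinCE e f c1 c2 X) {M : Finset V} (hMX : M ⊂ X)
    (hM : M.Nonempty) : 0 ≤ rho e f c1 c2 M := by
  by_contra! hneg
  have he := H.valid.mult_e.nonneg
  have hf := H.valid.mult_f.nonneg
  have h0 := H.valid.isReserve_zero
  have hX5 := H.rho_ge subset_rfl H.nonempty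
  have hM1 : rho e f c1 c2 M = -1 := by have := H.rho_ge_of_ssubset hMX hM; omega
  have hX : rho e f c1 c2 X = -5 := by have := H.rho_add_four_le hMX hM; omega
  have hwhole : ∀ A ⊆ X, A.Nonempty → rho e f c1 c2 A < -1 → A = X := by
    intro A hA hne hlt
    rcases hA.eq_or_ssubset with h | h
    · exact h
    · have := H.rho_ge_of_ssubset h hne; omega
  obtain ⟨s, hs, u, hu, hesu⟩ := H.exists_strong_edge hMX hM hM1
  obtain ⟨huX, huM⟩ := Finset.mem_sdiff.mp hu
  obtain ⟨φ, o, hc, hsp⟩ := H.exists_col_spare hMX s fun A hA hne => by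
    have := H.pot_ge_of_ssubset (lt_of_le_of_lt hA hMX) hne; omega
  have hφ : φ s = false := by
    by_contra hφ
    rw [Bool.not_eq_false] at hφ
    obtain ⟨A, hA, hAne, hle⟩ := H.exists_rho_union_add_le hMX.1 hc hs hφ
      (r := fun z => if z = u then 1 else 0) (by
        intro z
        have := he s z
        have := hf s z
        split_ifs with h
        · subst h; omega
        · omega) (by simpa [hu] using hsp hs hφ)
    rw [Finset.sum_ite_eq'] at hle
    have h7 : (0 : ℤ) ≤ if u ∈ A then 1 else 0 := by split_ifs <;> omega
    have heq := hwhole (M ∪ A) (Finset.union_subset hMX.1 (hA.trans Finset.sdiff_subset))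
      (hM.mono Finset.subset_union_left) (by omega)
    have huA : u ∈ A := by
      rw [← heq] at huX
      exact (Finset.mem_union.mp huX).resolve_left huM
    rw [if_pos huA, heq] at hle
    omega
  have hrins := rho_insert H.valid huM
  have ha1 : 1 ≤ ∑ y ∈ M, e u y := by
    have := Finset.single_le_sum (fun y _ => he u y) hs
    rw [H.valid.mult_e.symm u s] at this
    omega
  have hk0 : 0 ≤ ∑ y ∈ M, f u y := Finset.sum_nonneg fun y _ => hf u y
  have hdeg := H.degree_lower huX
  have hc2 := H.c2_nonneg huX
  have hc1le := H.valid.c1_le u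
  have hc2le := H.valid.c2_le u
  have hwdef : weight (c1 u) (c2 u) = 1 + 4 * max (c1 u) (-1) + 3 * max (c2 u) 0 := rfl
  have hinsX : insert u M ⊂ X := by
    refine (Finset.insert_subset huX hMX.1).ssubset_of_ne fun heq => ?_
    have hMe : M = X.erase u := by rw [← heq, Finset.erase_insert huM]
    rw [heq, hX, hM1, hMe, H.valid.mult_e.sum_erase, H.valid.mult_f.sum_erase] at hrins
    rw [hMe, H.valid.mult_e.sum_erase] at ha1
    have h6 : 0 ≤ ∑ y ∈ X, f u y := Finset.sum_nonneg fun y _ => hf u y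
    omega
  have hins1 := H.rho_ge_of_ssubset hinsX (Finset.insert_nonempty u M)
  have ha : ∑ y ∈ M, e u y = 1 := by omega
  have hc1 : 0 ≤ c1 u := by omega
  have hck : 2 ≤ c2 u - ∑ y ∈ M, f u y := by omega
  have hins4 : rho e f c1 c2 (insert u M) ≤ 4 := by omega
  have hdR : 2 ≤ ∑ y ∈ X \ insert u M, (e u y + f u y) := by
    have e1 := Finset.sum_sdiff (f := fun y => e u y + f u y) hinsX.1
    rw [Finset.sum_insert huM, H.valid.mult_e.irrefl, H.valid.mult_f.irrefl] at e1
    simp only [Finset.sum_add_distrib] at e1 ⊢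
    omega
  have hleft1 : left1 e f 0 0 φ M c1 u < 0 := by
    have := Finset.single_le_sum (f := fun s => if φ s then f s u - (0 : V → V → ℤ) s u
      else (0 : V → V → ℤ) s u + 9 * (e s u - (0 : V → V → ℤ) s u))
      (fun s _ => h0.left1_term_nonneg φ s u) hs
    simp only [hφ, Bool.false_eq_true, if_false, Pi.zero_apply, hesu] at this
    unfold left1
    simp only [Pi.zero_apply]
    omega
  have hrho : ∀ A ⊆ X \ M, rho e f c1 c2 (M ∪ A) + (if u ∈ A then 1 else 0) + 1
      ≤ rho e f (left1 e f 0 0 φ M c1) (left2 e f 0 0 φ M c2) A := by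
    intro A hA
    have h1 := H.valid.rho_union_le h0 φ (S := M) (A := A)
      (Finset.disjoint_of_subset_right hA Finset.disjoint_sdiff)
    have hn : ∀ y ∈ A, 0 ≤ ∑ s ∈ M, gain e f 0 0 φ s y :=
      fun y _ => Finset.sum_nonneg fun s _ => h0.gain_nonneg φ s y
    have h2 : (if u ∈ A then 1 else 0) ≤ ∑ y ∈ A, ∑ s ∈ M, gain e f 0 0 φ s y := by
      split_ifs with huA
      · refine le_trans ?_ (Finset.single_le_sum hn huA)
        refine le_trans ?_ (Finset.single_le_sum (fun s _ => h0.gain_nonneg φ s u) hs)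
        have := hf s u
        simp only [gain, hφ, Bool.false_eq_true, if_false, Pi.zero_apply]
        omega
      · exact Finset.sum_nonneg hn
    linarith
  have hle2 : 2 ≤ left2 e f 0 0 φ M c2 u := by
    have h1 : ∑ s ∈ M, (if φ s then (0 : V → V → ℤ) s u + 9 * (e s u - (0 : V → V → ℤ) s u)
        else f s u - (0 : V → V → ℤ) s u) ≤ ∑ y ∈ M, f u y := by
      refine Finset.sum_le_sum fun y hy => ?_
      simp only [Pi.zero_apply, H.valid.mult_f.symm u y]
      have := hf y u
      split_ifs with hφy
      · have hys : y ∈ M.erase s := Finset.mem_erase.mpr ⟨fun h => by simp [h, hφ] at hφy, hy⟩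
        have h2 := Finset.add_sum_erase M (e u) hs
        have h3 := Finset.single_le_sum (fun y _ => he u y) hys
        have h4 := H.valid.mult_e.symm u s
        have h5 := H.valid.mult_e.symm u y
        omega
      · omega
    unfold left2
    omega
  have hcard : ∀ B ⊆ X \ M, B.card < X.card := fun B hB =>
    Finset.card_lt_card (lt_of_le_of_lt hB (Finset.sdiff_ssubset hMX.1 hM))
  have hsing : M ∪ {u} = insert u M := by rw [Finset.union_comm, Finset.insert_eq]
  obtain ⟨ψ, o', hc', hψ, hload⟩ := H.exists_col_union_spare hc (B := {u}) (by simpa using huM)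
    (hcard {u} (by simpa using hu)) (Finset.mem_singleton_self u) (k := 2) (by norm_num) hleft1 (by
      intro A hA hne
      obtain rfl : A = {u} := (Finset.Nonempty.subset_singleton_iff hne).mp hA
      have h1 := hrho {u} (by simpa using hu)
      rw [rho_singleton (H.valid.left h0 φ M), hsing] at h1
      have V' := (H.valid.left h0 φ M).mono (c1' := left1 e f 0 0 φ M c1)
        (c2' := fun y => left2 e f 0 0 φ M c2 y - if y = u then 2 else 0) (fun _ => le_rfl)
        (fun y => by split_ifs <;> omega)
      rw [pot_eq_rho (by simpa using hle2), rho_singleton V']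
      simp only [Finset.mem_singleton, if_true] at h1 ⊢
      unfold weight at h1 ⊢
      omega)
  rw [hsing] at hc' hload
  obtain ⟨y1, hy1, y2, hy2, hunit⟩ := exists_two_units
    (fun y => add_nonneg (he u y) (hf u y)) hdR
  have hnn : ∀ y, (0 : ℤ) ≤ (if y = y1 then 1 else 0) + (if y = y2 then 1 else 0) := fun y => by
    split_ifs <;> omega
  obtain ⟨A, hA, hAne, hle⟩ := H.exists_rho_union_add_le hinsX.1 hc' (Finset.mem_insert_self u M)
    hψ (r := fun y => (if y = y1 then 1 else 0) + (if y = y2 then 1 else 0))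
    (fun y => ⟨hnn y, hunit y⟩) (by
      rw [Finset.sum_add_distrib, Finset.sum_ite_eq', Finset.sum_ite_eq', if_pos hy1, if_pos hy2]
      exact hload)
  have hAX : A ⊆ X := hA.trans Finset.sdiff_subset
  have hSA : insert u M ∪ A ⊆ X := Finset.union_subset hinsX.1 hAX
  have hSne : (insert u M ∪ A).Nonempty := (Finset.insert_nonempty u M).mono
    Finset.subset_union_left
  rw [Finset.sum_add_distrib, Finset.sum_ite_eq', Finset.sum_ite_eq'] at hle
  have hy1A : y1 ∉ A := by
    intro hy1A
    rw [if_pos hy1A] at hle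
    have h7 : (0 : ℤ) ≤ if y2 ∈ A then 1 else 0 := by split_ifs <;> omega
    have heq := hwhole _ hSA hSne (by omega)
    have hy2A : y2 ∈ A := by
      rw [← heq] at hy2
      simp only [Finset.mem_sdiff, Finset.mem_union] at hy2
      tauto
    rw [if_pos hy2A, heq] at hle
    omega
  have hy1X := (Finset.mem_sdiff.mp hy1).1
  have hy1S : y1 ∉ insert u M ∪ A := by
    simp only [Finset.mem_union, not_or]
    exact ⟨(Finset.mem_sdiff.mp hy1).2, hy1A⟩
  have hS2X : insert u M ∪ A ⊂ X := hSA.ssubset_of_ne fun h => hy1S (h ▸ hy1X)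
  have hr2 : rho e f c1 c2 (insert u M ∪ A) ≤ 1 := by
    have h7 : (0 : ℤ) ≤ if y2 ∈ A then 1 else 0 := by split_ifs <;> omega
    rw [if_neg hy1A] at hle
    omega
  have hMB : M ∪ insert u A = insert u M ∪ A := by
    rw [Finset.union_insert, Finset.insert_union]
  have hBX : insert u A ⊆ X \ M := by
    refine Finset.insert_subset hu fun y hy => ?_
    have := hA hy
    simp only [Finset.mem_sdiff, Finset.mem_insert, not_or] at this ⊢
    exact ⟨this.1, this.2.2⟩
  obtain ⟨ψ2, o2, hc2', hψ2, hload2⟩ := H.exists_col_union_spare hc (B := insert u A)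
    (Finset.disjoint_of_subset_right hBX Finset.disjoint_sdiff) (hcard _ hBX)
    (Finset.mem_insert_self u A) (k := 1) (by norm_num) hleft1 (by
      intro B hB hne
      have h1 := hrho B (hB.trans hBX)
      have h2 : M ∪ B ⊂ X := lt_of_le_of_lt (by
        rw [← hMB]; exact Finset.union_subset_union_right hB) hS2X
      have h3 := H.rho_ge_of_ssubset h2 (hM.mono Finset.subset_union_left)
      have h4 := pot_sub_cost_le (e := e) (f := f) (c1 := left1 e f 0 0 φ M c1)
        (c2 := left2 e f 0 0 φ M c2) (c1' := left1 e f 0 0 φ M c1)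
        (c2' := fun y => left2 e f 0 0 φ M c2 y - if y = u then 1 else 0) (δ1 := fun _ => 0)
        (δ2 := fun x => if x = u then 1 else 0) (A := B) (fun _ _ => le_rfl)
        (fun x _ => by split_ifs <;> omega) (fun x _ => by simp) (fun x _ => le_rfl)
      have h5 : ∑ x ∈ B, (4 * (0 : ℤ) + 3 * if x = u then 1 else 0)
          = 3 * if u ∈ B then 1 else 0 := by
        simp [mul_ite]
      rw [h5] at h4
      have h6 := penalty_le (c2 := left2 e f 0 0 φ M c2) B
      unfold pot at h4 ⊢
      split_ifs at h1 h4 <;> omega)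
  rw [hMB] at hc2' hload2
  obtain ⟨A2, hA2, hA2ne, hle2⟩ := H.exists_rho_union_add_le hSA hc2'
    (Finset.mem_union_left _ (Finset.mem_insert_self u M)) hψ2
    (r := fun y => if y = y1 then 1 else 0) (fun y => by
      have := hunit y
      have h7 : (0 : ℤ) ≤ if y = y2 then 1 else 0 := by split_ifs <;> omega
      refine ⟨by split_ifs <;> omega, by omega⟩) (by
      rw [Finset.sum_ite_eq', if_pos (Finset.mem_sdiff.mpr ⟨hy1X, hy1S⟩)]
      exact hload2)
  rw [Finset.sum_ite_eq'] at hle2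
  have h7 : (0 : ℤ) ≤ if y1 ∈ A2 then 1 else 0 := by split_ifs <;> omega
  have heq := hwhole _ (Finset.union_subset hSA (hA2.trans Finset.sdiff_subset))
    (hSne.mono Finset.subset_union_left) (by omega)
  have hy1A2 : y1 ∈ A2 := by
    rw [← heq] at hy1X
    exact (Finset.mem_union.mp hy1X).resolve_left hy1S
  rw [if_pos hy1A2, heq] at hle2
  omega

end ProperSubset

section StrongDegree

variable {V : Type*} {e f : V → V → ℤ} {c1 c2 : V → ℤ} {X : Finset V} [DecidableEq V]

/-- Lower bounds for the excess of a set avoiding a vertex `x`. -/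
lemma MinCE.rho_of_subset_erase_nonneg (H : MinCE e f c1 c2 X) {x : V} (hx : x ∈ X)
    {A : Finset V} (hA : A ⊆ X.erase x) :
    (A = X.erase x ∧ -5 - weight (c1 x) (c2 x) + 9 * ∑ y ∈ X, e x y + 4 * ∑ y ∈ X, f x y
      ≤ rho e f c1 c2 A) ∨
    (-weight (c1 x) (c2 x) + 9 * ∑ y ∈ A, e x y + 4 * ∑ y ∈ A, f x y ≤ rho e f c1 c2 A) := by
  rcases H.rho_of_subset_erase hx hA with h | ⟨h, -⟩
  · exact Or.inl h
  · have h1 := H.rho_nonneg h (Finset.insert_nonempty x A)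
    rw [rho_insert H.valid fun hxA => by simpa using hA hxA] at h1
    exact Or.inr (by linarith)

/-- The excess of a union of proper subsets is subadditive. -/
lemma MinCE.rho_union_le_add (H : MinCE e f c1 c2 X) {A B : Finset V} (hB : B ⊂ X) :
    rho e f c1 c2 (A ∪ B) ≤ rho e f c1 c2 A + rho e f c1 c2 B := by
  have h1 := rho_submod H.valid A B
  rcases (A ∩ B).eq_empty_or_nonempty with h | h
  · rw [h, rho_empty] at h1
    linarith
  · have := H.rho_nonneg (lt_of_le_of_lt Finset.inter_subset_right hB) h
    linarith

/-- A low-excess set containing a strong neighbor and a weak neighbor of `x`. -/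
lemma MinCE.exists_tight_strong (H : MinCE e f c1 c2 X) {x z y : V} (hx : x ∈ X)
    (h1 : c1 x = 1) (hz : z ∈ X) (hez : e x z = 1) (hs : ∑ y ∈ X, e x y = 1)
    (ht : ∑ y ∈ X, f x y = c2 x + 1) (hy : y ∈ X) (hfy : 1 ≤ f x y) :
    ∃ A ⊆ X.erase x, z ∈ A ∧ y ∈ A ∧ rho e f c1 c2 A ≤ 1 := by
  have he := H.valid.mult_e.nonneg
  have hf := H.valid.mult_f.nonneg
  have hez' : ∀ u ∈ X, u ≠ z → e x u = 0 := by
    intro u hu huz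
    have h2 := Finset.add_sum_erase X (e x) hz
    have h3 := Finset.single_le_sum (f := e x) (fun y _ => he x y)
      (Finset.mem_erase.mpr ⟨huz, hu⟩)
    have := he x u
    omega
  have hyx : y ≠ x := by
    rintro rfl
    rw [H.valid.mult_f.irrefl] at hfy
    omega
  by_contra! hno
  refine H.extend hx (fun u => if u = y then 1 else 0) (fun u => if u = z then 1 else 0)
    (fun u => by split_ifs <;> omega) (fun u => by split_ifs <;> omega) ?_ ?_
  · intro A hA hne
    rw [H.pot_eq_of_subset_erase hA, Finset.sum_add_distrib, ← Finset.mul_sum, ← Finset.mul_sum,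
      Finset.sum_ite_eq', Finset.sum_ite_eq']
    have h2 := H.rho_nonneg (lt_of_le_of_lt hA (Finset.erase_ssubset hx)) hne
    have h3 := hno A hA
    split_ifs with h4 h5
    · have := h3 h5 h4; omega
    all_goals omega
  · intro φ _
    have hp : ∀ u, (0 : ℤ) ≤ (if u = y then 1 else 0) ∧ (if u = y then 1 else 0) ≤ f x u := by
      intro u
      have := hf x u
      split_ifs with h
      · subst h; omega
      · omega
    have hsum := sum_true_add_sum_false (e x) (fun u => f x u - if u = y then 1 else 0) φ
      (X.erase x)
    rw [Finset.sum_sub_distrib, Finset.sum_ite_eq', if_pos (Finset.mem_erase.mpr ⟨hyx, hy⟩),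
      H.valid.mult_e.sum_erase, H.valid.mult_f.sum_erase] at hsum
    by_cases h2 : ∑ u ∈ X.erase x,
        (if true = φ u then e x u else f x u - if u = y then 1 else 0) ≤ c2 x
    · refine ⟨true, fun u => if u = y then 1 else 0, hp, by simpa using h2, fun u hu => ?_⟩
      have h3 := hez' u (Finset.mem_of_mem_erase hu)
      by_cases huz : u = z
      · subst huz
        cases φ u <;> simp [hez]
      · cases φ u <;> simp [h3 huz, huz]
    · have hn : ∀ u ∈ X.erase x, (0 : ℤ) ≤
          if false = φ u then e x u else f x u - if u = y then 1 else 0 := by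
        intro u _
        have := he x u
        have := hp u
        split_ifs at * <;> omega
      have hF := Finset.sum_nonneg hn
      have hF0 := (Finset.sum_eq_zero_iff_of_nonneg hn).mp (by omega)
      refine ⟨false, 0, fun u => ⟨le_rfl, hf x u⟩, ?_, fun u hu => ?_⟩
      · have h4 : ∑ u ∈ X.erase x, (if false = φ u then e x u else f x u - (0 : V → ℤ) u)
            ≤ ∑ u ∈ X.erase x, ((if false = φ u then e x u
              else f x u - if u = y then 1 else 0) + if u = y then 1 else 0) := by
          refine Finset.sum_le_sum fun u _ => ?_
          simp only [Pi.zero_apply]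
          split_ifs <;> omega
        rw [Finset.sum_add_distrib, Finset.sum_ite_eq',
          if_pos (Finset.mem_erase.mpr ⟨hyx, hy⟩)] at h4
        simp only [Bool.false_eq_true, if_false]
        omega
      · have h3 := hF0 u hu
        cases hu' : φ u
        · simp only [hu', if_true] at h3
          simp only [h3, if_true, Bool.false_eq_true, if_false]
          split_ifs <;> omega
        · simp only [Bool.false_eq_true, if_false, Pi.zero_apply, if_true]
          split_ifs <;> omega

lemma MinCE.degree_lower_of_strong (H : MinCE e f c1 c2 X) {x : V} (hx : x ∈ X) (h1 : c1 x = 1)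
    (hs : ∑ y ∈ X, e x y = 1) : c2 x + 2 ≤ ∑ y ∈ X, f x y := by
  have he := H.valid.mult_e.nonneg
  have hf := H.valid.mult_f.nonneg
  have hc2 := H.c2_nonneg hx
  have hc2le := H.valid.c2_le x
  by_contra hcon
  have ht : ∑ y ∈ X, f x y = c2 x + 1 := by
    have := (H.degree_lower hx).2 (by omega)
    omega
  obtain ⟨z, hz, hez⟩ : ∃ z ∈ X, e x z = 1 := by
    by_contra! hno
    have : ∑ y ∈ X, e x y = 0 := Finset.sum_eq_zero fun y hy => by
      have := hno y hy; have := he x y; have := H.valid.e_le x y; omega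
    omega
  have hw : weight (c1 x) (c2 x) = 5 + 3 * c2 x := by unfold weight; omega
  have htight : ∀ A ⊆ X.erase x, z ∈ A → rho e f c1 c2 A ≤ 1 → 1 ≤ ∑ y ∈ A, f x y →
      c2 x = 3 ∧ ∑ y ∈ A, f x y = 1 := by
    intro A hA hzA hr hk
    have h3 := Finset.single_le_sum (f := e x) (fun y _ => he x y) hzA
    rcases H.rho_of_subset_erase_nonneg hx hA with ⟨-, h2⟩ | h2 <;> omega
  obtain ⟨y1, hy1, hfy1⟩ : ∃ y ∈ X, 0 < f x y := by
    by_contra! hno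
    have := Finset.sum_nonpos hno
    omega
  obtain ⟨A1, hA1, hz1, hyA1, hr1⟩ := H.exists_tight_strong hx h1 hz hez hs ht hy1 hfy1
  obtain ⟨hc3, hk1⟩ := htight A1 hA1 hz1 hr1
    (le_trans hfy1 (Finset.single_le_sum (f := f x) (fun y _ => hf x y) hyA1))
  obtain ⟨y2, hy2, hfy2⟩ : ∃ y ∈ X \ A1, 0 < f x y := by
    by_contra! hno
    have := Finset.sum_nonpos hno
    have := Finset.sum_sdiff (f := f x) (hA1.trans (Finset.erase_subset x X))
    omega
  obtain ⟨hy2X, hy2A⟩ := Finset.mem_sdiff.mp hy2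
  obtain ⟨A2, hA2, hz2, hyA2, hr2⟩ := H.exists_tight_strong hx h1 hz hez hs ht hy2X hfy2
  obtain ⟨-, hk2⟩ := htight A2 hA2 hz2 hr2
    (le_trans hfy2 (Finset.single_le_sum (f := f x) (fun y _ => hf x y) hyA2))
  have hU := H.rho_union_le_add (A := A1) (lt_of_le_of_lt hA2 (Finset.erase_ssubset hx))
  have hkU : ∑ y ∈ A1 ∪ A2, f x y ≤ 2 := by
    have h2 := Finset.sum_union_inter (f := f x) (s₁ := A1) (s₂ := A2)
    have h3 : 0 ≤ ∑ y ∈ A1 ∩ A2, f x y := Finset.sum_nonneg fun y _ => hf x y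
    omega
  have hkU2 : 2 ≤ ∑ y ∈ A1 ∪ A2, f x y := by
    have h2 : ∑ y ∈ insert y2 A1, f x y ≤ ∑ y ∈ A1 ∪ A2, f x y :=
      Finset.sum_le_sum_of_subset_of_nonneg
        (Finset.insert_subset (Finset.mem_union_right _ hyA2) Finset.subset_union_left)
        fun y _ _ => hf x y
    rw [Finset.sum_insert hy2A] at h2
    omega
  have heU := Finset.single_le_sum (f := e x) (fun y _ => he x y) (Finset.mem_union_left A2 hz1)
  rcases H.rho_of_subset_erase_nonneg hx (Finset.union_subset hA1 hA2) with ⟨h2, -⟩ | h2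
  · rw [h2, H.valid.mult_f.sum_erase] at hkU
    omega
  · omega

/-- A low-excess set containing a given neighbor of a vertex without strong edges. -/
lemma MinCE.exists_tight_weak (H : MinCE e f c1 c2 X) {x y : V} (hx : x ∈ X)
    (h1 : c1 x = 1) (hs : ∑ y ∈ X, e x y = 0)
    (ht : ∑ y ∈ X, f x y = c2 x + 3) (hy : y ∈ X) (hfy : 1 ≤ f x y) :
    ∃ A ⊆ X.erase x, y ∈ A ∧ rho e f c1 c2 A ≤ 1 := by
  have he := H.valid.mult_e.nonneg
  have hf := H.valid.mult_f.nonneg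
  have hez := (Finset.sum_eq_zero_iff_of_nonneg fun y _ => he x y).mp hs
  have hyx : y ≠ x := by
    rintro rfl
    rw [H.valid.mult_f.irrefl] at hfy
    omega
  by_contra! hno
  refine H.extend hx (fun u => if u = y then 1 else 0) (fun u => if u = y then 1 else 0)
    (fun u => by split_ifs <;> omega) (fun u => by split_ifs <;> omega) ?_ ?_
  · intro A hA hne
    rw [H.pot_eq_of_subset_erase hA, Finset.sum_add_distrib, ← Finset.mul_sum, ← Finset.mul_sum,
      Finset.sum_ite_eq']
    have h2 := H.rho_nonneg (lt_of_le_of_lt hA (Finset.erase_ssubset hx)) hne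
    have h3 := hno A hA
    split_ifs with h4
    · have := h3 h4; omega
    · omega
  · intro φ _
    have hp : ∀ u, (0 : ℤ) ≤ (if u = y then 1 else 0) ∧ (if u = y then 1 else 0) ≤ f x u := by
      intro u
      have := hf x u
      split_ifs with h
      · subst h; omega
      · omega
    have hsum := sum_true_add_sum_false (e x) (fun u => f x u - if u = y then 1 else 0) φ
      (X.erase x)
    rw [Finset.sum_sub_distrib, Finset.sum_ite_eq', if_pos (Finset.mem_erase.mpr ⟨hyx, hy⟩),
      H.valid.mult_e.sum_erase, H.valid.mult_f.sum_erase] at hsum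
    have hδ : ∀ i : Bool, ∀ u ∈ X.erase x, (if i = φ u then e x u else if u = y then 1 else 0)
        ≤ if φ u then (if u = y then (1 : ℤ) else 0) else if u = y then 1 else 0 := by
      intro i u hu
      have := hez u (Finset.mem_of_mem_erase hu)
      split_ifs <;> omega
    by_cases h2 : ∑ u ∈ X.erase x,
        (if true = φ u then e x u else f x u - if u = y then 1 else 0) ≤ c2 x
    · exact ⟨true, _, hp, by simpa using h2, hδ true⟩
    · exact ⟨false, _, hp, by simp only [Bool.false_eq_true, if_false]; omega, hδ false⟩

lemma MinCE.degree_lower_of_weak (H : MinCE e f c1 c2 X) {x : V} (hx : x ∈ X) (h1 : c1 x = 1)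
    (hs : ∑ y ∈ X, e x y = 0) : c2 x + 4 ≤ ∑ y ∈ X, f x y := by
  have he := H.valid.mult_e.nonneg
  have hf := H.valid.mult_f.nonneg
  have hc2 := H.c2_nonneg hx
  have hc2le := H.valid.c2_le x
  by_contra hcon
  have ht : ∑ y ∈ X, f x y = c2 x + 3 := by
    have := H.weak_degree_lower hx h1 hs
    omega
  have hw : weight (c1 x) (c2 x) = 5 + 3 * c2 x := by unfold weight; omega
  have hlow : ∀ U ⊆ X.erase x, c2 x + 2 ≤ rho e f c1 c2 U ∧ ∑ y ∈ U, f x y = c2 x + 3 ∨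
      4 * ∑ y ∈ U, f x y ≤ rho e f c1 c2 U + 5 + 3 * c2 x := by
    intro U hU
    have h0 : 0 ≤ ∑ y ∈ U, e x y := Finset.sum_nonneg fun y _ => he x y
    rcases H.rho_of_subset_erase_nonneg hx hU with ⟨rfl, h2⟩ | h2
    · rw [H.valid.mult_f.sum_erase]; omega
    · omega
  have hkle : ∀ U ⊆ X.erase x, ∑ y ∈ U, f x y ≤ c2 x + 3 := fun U hU => by
    rw [← ht]
    exact Finset.sum_le_sum_of_subset_of_nonneg (hU.trans (Finset.erase_subset _ _))
      fun y _ _ => hf x y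
  have hgrow : ∀ j : ℤ, 0 ≤ j → ∀ n : ℕ, ∀ U ⊆ X.erase x, ∑ y ∈ U, f x y ≤ c2 x + 1 →
      c2 x + 1 - ∑ y ∈ U, f x y < n → rho e f c1 c2 U + j ≤ ∑ y ∈ U, f x y →
      j = 0 ∧ ∃ A ⊆ X.erase x, rho e f c1 c2 A ≤ 1 ∧ 2 ≤ ∑ y ∈ A, f x y := by
    intro j hj n
    induction n with
    | zero => intro U hU hk hn; simp only [Nat.cast_zero] at hn; omega
    | succ n ih =>
      intro U hU hk hn hr
      obtain ⟨y, hy, hfy⟩ : ∃ y ∈ X \ U, 0 < f x y := by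
        by_contra! hno
        have := Finset.sum_nonpos hno
        have := Finset.sum_sdiff (f := f x) (hU.trans (Finset.erase_subset x X))
        omega
      obtain ⟨hyX, hyU⟩ := Finset.mem_sdiff.mp hy
      obtain ⟨A, hA, hyA, hrA⟩ := H.exists_tight_weak hx h1 hs ht hyX hfy
      have hUA := H.rho_union_le_add (A := U) (lt_of_le_of_lt hA (Finset.erase_ssubset hx))
      have hsub := Finset.union_subset hU hA
      have hkA : ∑ y ∈ U ∪ A, f x y ≤ ∑ y ∈ U, f x y + ∑ y ∈ A, f x y := by
        have h2 := Finset.sum_union_inter (f := f x) (s₁ := U) (s₂ := A)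
        have h3 : 0 ≤ ∑ y ∈ U ∩ A, f x y := Finset.sum_nonneg fun y _ => hf x y
        omega
      have hkU : ∑ y ∈ U, f x y + 1 ≤ ∑ y ∈ U ∪ A, f x y := by
        have h2 : ∑ y ∈ insert y U, f x y ≤ ∑ y ∈ U ∪ A, f x y :=
          Finset.sum_le_sum_of_subset_of_nonneg
            (Finset.insert_subset (Finset.mem_union_right _ hyA) Finset.subset_union_left)
            fun y _ _ => hf x y
        rw [Finset.sum_insert hyU] at h2
        omega
      have hl := hlow _ hsub
      have hkm := hkle _ hsub
      by_cases hk' : ∑ y ∈ U ∪ A, f x y ≤ c2 x + 1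
      · exact ih _ hsub hk' (by push_cast at hn; omega) (by omega)
      · exact ⟨by omega, A, hA, hrA, by omega⟩
  obtain ⟨-, A, hA, hrA, hkA⟩ := hgrow 0 le_rfl (c2 x + 2).toNat ∅ (Finset.empty_subset _)
    (by simp; omega) (by simp) (by simp [rho_empty])
  have hlA := hlow A hA
  have := (hgrow 1 zero_le_one (c2 x + 2).toNat A hA (by omega) (by omega) (by omega)).1
  omega

end StrongDegree

section Discharging

variable {V : Type*} {e f : V → V → ℤ} {c1 c2 : V → ℤ} {X : Finset V} [DecidableEq V]

/-- Twice the weight of a vertex minus the weight of its incident edges. -/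
def charge (e f : V → V → ℤ) (c1 c2 : V → ℤ) (X : Finset V) (x : V) : ℤ :=
  2 * weight (c1 x) (c2 x) - ∑ y ∈ X, (9 * e x y + 4 * f x y)

lemma MinCE.charge_le (H : MinCE e f c1 c2 X) {x : V} (hx : x ∈ X) :
    charge e f c1 c2 X x ≤ 0 ∧
    (∑ y ∈ X, e x y = c2 x → charge e f c1 c2 X x ≤ -4) ∧
    (c2 x < ∑ y ∈ X, e x y → charge e f c1 c2 X x ≤ -6) ∧
    (c2 x < ∑ y ∈ X, e x y → -10 ≤ charge e f c1 c2 X x →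
      c1 x = 1 ∧ ∑ y ∈ X, f x y ≤ 2 ∧ (∑ y ∈ X, f x y = 2 → charge e f c1 c2 X x ≤ -7)) := by
  have hs : 0 ≤ ∑ y ∈ X, e x y := Finset.sum_nonneg fun y _ => H.valid.mult_e.nonneg x y
  have ht : 0 ≤ ∑ y ∈ X, f x y := Finset.sum_nonneg fun y _ => H.valid.mult_f.nonneg x y
  have h1 := H.degree_lower hx
  have h2 := H.degree_lower_of_strong hx
  have h3 := H.degree_lower_of_weak hx
  have h4 := H.c2_nonneg hx
  have h5 := H.valid.c2_le x
  have h6 := H.valid.c1_le x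
  have hw : weight (c1 x) (c2 x) = 1 + 4 * max (c1 x) (-1) + 3 * max (c2 x) 0 := rfl
  unfold charge
  rw [Finset.sum_add_distrib, ← Finset.mul_sum, ← Finset.mul_sum]
  generalize ∑ y ∈ X, e x y = s at *
  generalize ∑ y ∈ X, f x y = t at *
  refine ⟨?_, fun h => ?_, fun h => ?_, fun h h' => ⟨?_, ?_, ?_⟩⟩ <;> omega

/-- Coloring a single vertex `x` with the first color, loading `r` on the other vertices. -/
lemma Valid.exists_isCol_single (H : Valid e f c1 c2) {x : V} {r : V → ℤ}
    (hr : ∀ y, 0 ≤ r y ∧ r y ≤ f x y) (hx : ∑ y ∈ X, f x y - ∑ y ∈ X, r y ≤ c1 x)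
    (hload : ∀ y ∈ X, y ≠ x → ∑ z ∈ X, e y z + r y ≤ c2 y) : ∃ φ o, IsCol e f c1 c2 X φ o := by
  have he := H.mult_e.nonneg
  refine ⟨fun y => decide (y ≠ x),
    fun a b => if a = x then f x b - r b else if b = x then r a else 0, ?_, ?_, ?_⟩
  · intro a b
    have := hr a
    have := hr b
    split_ifs <;> omega
  · intro a _ b _ hab
    by_cases ha : a = x
    · have hb : b ≠ x := fun hb => hab (by rw [ha, hb])
      subst ha
      simp [hb]
    · have hb : b = x := by
        by_contra hb
        exact hab (by simp [ha, hb])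
      subst hb
      simp [ha, H.mult_f.symm a b]
  · intro a ha
    by_cases hax : a = x
    · subst hax
      simp only [ne_eq, not_true_eq_false, decide_false, Bool.false_eq_true, if_false, if_true]
      refine le_trans ?_ hx
      rw [← Finset.sum_sub_distrib]
      refine Finset.sum_le_sum fun y _ => ?_
      have := hr y
      by_cases hy : y = a
      · subst hy
        simp [H.mult_e.irrefl, this.2]
      · simp [hy]
    · have h1 := hload a ha hax
      have h2 : ∑ y ∈ X, (if decide (a ≠ x) = decide (y ≠ x) then e a y
            else if a = x then f x y - r y else if y = x then r a else 0)
          ≤ ∑ y ∈ X, (e a y + if y = x then r a else 0) := by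
        refine Finset.sum_le_sum fun y _ => ?_
        have := he a y
        by_cases hy : y = x
        · simp [hax, hy, H.mult_e.nonneg]
        · simp [hax, hy]
      rw [Finset.sum_add_distrib, Finset.sum_ite_eq'] at h2
      have h3 := (hr a).1
      have h4 : (if x ∈ X then r a else 0) ≤ r a := by split_ifs <;> omega
      refine h2.trans ?_
      simp only [ne_eq, hax, not_false_eq_true, decide_true, if_true]
      linarith

lemma MinCE.elim (H : MinCE e f c1 c2 X) : False := by
  have hf := H.valid.mult_f.nonneg
  refine H.not_col ?_
  by_cases hall : ∀ x ∈ X, ∑ y ∈ X, e x y ≤ c2 x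
  · exact ⟨fun _ => true, fun _ _ => 0, fun _ _ => le_rfl, by simp, by simpa using hall⟩
  push Not at hall
  obtain ⟨x, hx, hsx⟩ := hall
  have hsum : -10 ≤ ∑ y ∈ X, charge e f c1 c2 X y := by
    have h1 := two_mul_excess (w := fun x => weight (c1 x) (c2 x)) H.valid.mult X
    have h2 := H.rho_ge subset_rfl H.nonempty
    unfold rho at h2
    unfold charge
    linarith
  have hneg : ∀ s : Finset V, s ⊆ X → ∑ y ∈ s, charge e f c1 c2 X y ≤ 0 := fun s hs =>
    Finset.sum_nonpos fun y hy => (H.charge_le (hs hy)).1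
  have hsplit := Finset.add_sum_erase X (charge e f c1 c2 X) hx
  have hx1 := hneg _ (Finset.erase_subset x X)
  obtain ⟨-, -, hx6, hx10⟩ := H.charge_le hx
  obtain ⟨hc1, ht, hx7⟩ := hx10 hsx (by omega)
  have hx6 := hx6 hsx
  have hother : ∀ y ∈ X, y ≠ x → -10 ≤ charge e f c1 c2 X x + charge e f c1 c2 X y := by
    intro y hy hyx
    have h1 := Finset.add_sum_erase _ (charge e f c1 c2 X) (Finset.mem_erase.mpr ⟨hyx, hy⟩)
    have h2 := hneg _ ((Finset.erase_subset y _).trans (Finset.erase_subset x X))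
    omega
  have hle : ∀ y ∈ X, y ≠ x → ∑ z ∈ X, e y z ≤ c2 y := by
    intro y hy hyx
    have h1 := hother y hy hyx
    have h2 := (H.charge_le hy).2.2.1
    omega
  by_cases ht2 : ∑ y ∈ X, f x y ≤ 1
  · exact H.valid.exists_isCol_single (r := 0) (fun y => ⟨le_rfl, hf x y⟩)
      (by simpa [hc1] using ht2) (by simpa using hle)
  have hx7 := hx7 (by omega)
  obtain ⟨z, hz, hfz⟩ : ∃ y ∈ X, 0 < f x y := by
    by_contra! hno
    have := Finset.sum_nonpos hno
    omega
  refine H.valid.exists_isCol_single (x := x) (r := fun y => if y = z then 1 else 0)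
    (fun y => ?_) ?_ fun y hy hyx => ?_
  · have := hf x y
    split_ifs with h
    · subst h; omega
    · omega
  · rw [Finset.sum_ite_eq', if_pos hz, hc1]
    omega
  · have h1 := hother y hy hyx
    have h2 := hle y hy hyx
    have h3 := (H.charge_le hy).2.1
    split_ifs <;> omega

/-- Sets all of whose nonempty subsets have potential at least `-5` are colorable. -/
theorem Valid.exists_isCol (H : Valid e f c1 c2)
    (hpot : ∀ A ⊆ X, A.Nonempty → -5 ≤ pot e f c1 c2 A) : ∃ φ o, IsCol e f c1 c2 X φ o := by
  induction hn : X.card using Nat.strong_induction_on generalizing X f c1 c2 with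
  | _ n ih =>
    by_contra hcol
    exact MinCE.elim ⟨H, hpot, hcol, fun Y f' c1' c2' hY HY hpotY =>
      ih _ (hn ▸ hY) HY hpotY rfl⟩

end Discharging

open Classical in
lemma two_mul_edgesIn {V : Type*} [Fintype V] (G : SimpleGraph V) (A : Finset V) :
    2 * edgesIn G ↑A = ∑ x ∈ A, ∑ y ∈ A, if G.Adj x y then 1 else 0 := by
  let H : SimpleGraph V :=
    { Adj := fun x y => G.Adj x y ∧ x ∈ A ∧ y ∈ A
      symm := ⟨fun x y h => ⟨h.1.symm, h.2.2, h.2.1⟩⟩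
      loopless := ⟨fun x h => G.irrefl h.1⟩ }
  have h1 : edgesIn G ↑A = H.edgeFinset.card := by
    rw [edgesIn, ← Set.ncard_coe_finset, SimpleGraph.coe_edgeFinset]
    congr 1
    ext a
    induction a with
    | h x y => simp [H]
  have h2 : ∀ x, H.degree x = if x ∈ A then ∑ y ∈ A, if G.Adj x y then 1 else 0 else 0 := by
    intro x
    rw [← SimpleGraph.card_neighborFinset_eq_degree, Finset.sum_boole]
    split_ifs with hx
    · rw [Nat.cast_id]
      congr 1
      ext y
      simp [H, hx, and_comm]
    · rw [Finset.card_eq_zero]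
      ext y
      simp [H, hx]
  rw [h1, ← H.sum_degrees_eq_twice_card_edges]
  simp [h2]

open Classical in
/-- A graph whose vertex subsets all have potential at least `-5` is colorable. -/
theorem cColorable_of_potential {V : Type*} [Fintype V] (G : SimpleGraph V) (c1 c2 : V → ℤ)
    (hc1 : ∀ v, -1 ≤ c1 v ∧ c1 v ≤ 1) (hc2 : ∀ v, -1 ≤ c2 v ∧ c2 v ≤ 3)
    (hpot : ∀ A : Finset V,
      -5 ≤ (∑ v ∈ A, (1 + 4 * c1 v + 3 * c2 v)) - 9 * (edgesIn G ↑A : ℤ)) :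
    CColorable G c1 c2 := by
  have hvalid : Valid (fun x y => if G.Adj x y then 1 else 0) (fun _ _ => 0) c1 c2 :=
    { mult_e := ⟨fun x y => by simp [G.adj_comm], fun x y => by split_ifs <;> simp,
        fun x => by simp⟩
      e_le := fun x y => by split_ifs <;> simp
      mult_f := ⟨fun _ _ => rfl, fun _ _ => le_rfl, fun _ => rfl⟩
      c1_le := fun x => (hc1 x).2
      c2_le := fun x => (hc2 x).2 }
  obtain ⟨φ, o, hcol⟩ := hvalid.exists_isCol (X := Finset.univ) fun A _ _ => by
    refine (hpot A).trans ?_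
    have h1 := two_mul_excess (w := fun x => weight (c1 x) (c2 x)) hvalid.mult A
    have h2 : (2 * edgesIn G ↑A : ℤ) = ∑ x ∈ A, ∑ y ∈ A, if G.Adj x y then 1 else 0 := by
      exact_mod_cast two_mul_edgesIn G A
    have h3 : ∑ x ∈ A, (1 + 4 * c1 x + 3 * c2 x) + penalty c2 A
        ≤ ∑ x ∈ A, weight (c1 x) (c2 x) := by
      have hle : ∀ x ∈ A, 1 + 4 * c1 x + 3 * c2 x ≤ weight (c1 x) (c2 x) := fun x _ => by
        unfold weight; omega
      unfold penalty
      split_ifs with h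
      · obtain ⟨x, hx, hneg⟩ := h
        have h4 := Finset.add_sum_erase A (fun x => 1 + 4 * c1 x + 3 * c2 x) hx
        have h5 := Finset.add_sum_erase A (fun x => weight (c1 x) (c2 x)) hx
        have h6 := Finset.sum_le_sum fun y hy => hle y (Finset.mem_of_mem_erase (a := x) hy)
        have h7 : 1 + 4 * c1 x + 3 * c2 x + 3 ≤ weight (c1 x) (c2 x) := by
          have := hc1 x; have := hc2 x
          unfold weight; omega
        linarith
      · simpa using Finset.sum_le_sum hle
    simp only [mul_zero, add_zero, Finset.sum_sub_distrib, ← Finset.mul_sum, ← h2] at h1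
    unfold pot rho
    simp only [mul_zero, add_zero]
    linarith
  refine ⟨fun v => if φ v then 1 else 0, fun v => ?_⟩
  have h1 := hcol.load v (Finset.mem_univ v)
  have h2 : ((G.neighborSet v ∩ {u | (if φ u then (1 : Fin 2) else 0) = if φ v then 1 else 0}).ncard
      : ℤ) ≤ ∑ y, if φ v = φ y then (if G.Adj v y then 1 else 0) else o v y := by
    have h3 : G.neighborSet v ∩ {u | (if φ u then (1 : Fin 2) else 0) = if φ v then 1 else 0}
        = ↑(Finset.univ.filter fun y => φ v = φ y ∧ G.Adj v y) := by
      ext y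
      cases φ v <;> cases hy : φ y <;> simp [hy]
    rw [h3, Set.ncard_coe_finset, Finset.card_filter, Nat.cast_sum]
    refine Finset.sum_le_sum fun y _ => ?_
    have := hcol.nonneg v y
    by_cases h4 : φ v = φ y <;> by_cases h5 : G.Adj v y <;> simp [h4, h5, this]
  refine (h2.trans h1).trans (le_of_eq ?_)
  by_cases hv : φ v <;> simp [hv]

end DefectiveColoring

/-- Theorem 3: if G is c-critical, then some set A has potential
∑_{v∈A} (1 + 4c₁(v) + 3c₂(v)) - 9|E(G[A])| at most -6. -/
theorem stmt8 {V : Type*} [Fintype V] (G : SimpleGraph V) (c1 c2 : V → ℤ)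
    (hc1 : ∀ v, -1 ≤ c1 v ∧ c1 v ≤ 1) (hc2 : ∀ v, -1 ≤ c2 v ∧ c2 v ≤ 3)
    (hncol : ¬ CColorable G c1 c2)
    (hcrit : ∀ H : G.Subgraph, H ≠ ⊤ →
      CColorable H.coe (fun v => c1 v.1) (fun v => c2 v.1)) :
    ∃ A : Finset V,
      (∑ v ∈ A, (1 + 4 * c1 v + 3 * c2 v)) - 9 * (edgesIn G ↑A : ℤ) ≤ -6 := by
  by_contra! h
  exact hncol (DefectiveColoring.cColorable_of_potential G c1 c2 hc1 hc2 fun A => by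
    have := h A
    omega)
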